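/- arXiv:0807.4996 — 4 statements merged into one kernel-verified Lean document; each statement's English description precedes it below -/
import Mathlib

section
/- Let f ∈ ℝ[[x,y]] be a formal power series in two variables and let n be a positive integer. If f is nonnegative at every ordering of the field ℝ((x,y)) at which x > 0, y > 0 and x^n − y > 0, then f lies in the preordering of ℝ[[x,y]] generated by x, y and x^n − y. -/
noncomputable section

open MvPowerSeries MvPolynomial

/-- `ℝ[[x,y]]` is an integral domain. -/
instance : IsDomain (MvPowerSeries (Fin 2) ℝ) := NoZeroDivisors.to_isDomain _

/-- The ring of formal power series `ℝ[[x,y]]`. -/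
abbrev PS : Type := MvPowerSeries (Fin 2) ℝ

/-- The field `ℝ((x,y))`, the quotient field of `ℝ[[x,y]]`. -/
abbrev FF : Type := FractionRing PS

/-- The canonical embedding `ℝ[[x,y]] → ℝ((x,y))`. -/
abbrev ι : PS →+* FF := algebraMap PS FF

/-- The power series `x`. -/
abbrev psX : PS := MvPowerSeries.X 0

/-- The power series `y`. -/
abbrev psY : PS := MvPowerSeries.X 1

/-- The preordering of a commutative ring `A` generated by a subset `S`:
the smallest subsemiring of `A` containing `S` together with all squares. -/
def preorderingGen {A : Type*} [CommRing A] (S : Set A) : Set A :=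
  (Subsemiring.closure (S ∪ {a | ∃ b, a = b ^ 2}) : Set A)

/-- An ordering of a field `F`: a subset `P` with `P + P ⊆ P`, `P·P ⊆ P`,
`P ∪ (−P) = F` and `P ∩ (−P) = {0}`. -/
def IsOrderingF {F : Type*} [Field F] (P : Set F) : Prop :=
  (∀ a ∈ P, ∀ b ∈ P, a + b ∈ P) ∧ (∀ a ∈ P, ∀ b ∈ P, a * b ∈ P) ∧
  (∀ a : F, a ∈ P ∨ -a ∈ P) ∧ (∀ a : F, a ∈ P → -a ∈ P → a = 0)



/-! ### Orderings (cones) of domains -/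

structure IsCone {R : Type*} [CommRing R] (S : Set R) : Prop where
  add : ∀ a ∈ S, ∀ b ∈ S, a + b ∈ S
  mul : ∀ a ∈ S, ∀ b ∈ S, a * b ∈ S
  total : ∀ a : R, a ∈ S ∨ -a ∈ S
  anti : ∀ a : R, a ∈ S → -a ∈ S → a = 0

namespace IsCone

variable {R : Type*} [CommRing R] {S : Set R}

lemma mul_self (h : IsCone S) (a : R) : a * a ∈ S := by
  rcases h.total a with ha | ha
  · exact h.mul _ ha _ ha
  · have := h.mul _ ha _ ha
    rwa [neg_mul_neg] at this

lemma sq (h : IsCone S) (a : R) : a ^ 2 ∈ S := by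
  rw [pow_two]; exact h.mul_self a

lemma one (h : IsCone S) : (1 : R) ∈ S := by simpa using h.mul_self 1

lemma zero (h : IsCone S) : (0 : R) ∈ S := by simpa using h.mul_self 0

lemma pow (h : IsCone S) {a : R} (ha : a ∈ S) (n : ℕ) : a ^ n ∈ S := by
  induction n with
  | zero => simpa using h.one
  | succ n ih => rw [pow_succ]; exact h.mul _ ih _ ha

lemma comap {R' : Type*} [CommRing R'] (h : IsCone S) (e : R' →+* R)
    (he : Function.Injective e) : IsCone (e ⁻¹' S) where
  add a ha b hb := by simpa using h.add _ ha _ hb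
  mul a ha b hb := by simpa using h.mul _ ha _ hb
  total a := by simpa using h.total (e a)
  anti a ha hb := by
    apply he
    rw [map_zero]
    exact h.anti _ ha (by simpa using hb)

/-- Sign cancellation. -/
lemma cancel [IsDomain R] (h : IsCone S) {a b : R} (ha : a ∈ S) (ha0 : a ≠ 0)
    (hab : a * b ∈ S) : b ∈ S := by
  rcases h.total b with hb | hb
  · exact hb
  · have h1 := h.mul _ ha _ hb
    rw [mul_neg] at h1
    have h2 := h.anti _ hab h1
    rcases mul_eq_zero.1 h2 with h3 | h3
    · exact absurd h3 ha0
    · rw [h3]; exact h.zero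

lemma semiring_le (h : IsCone S) {G : Set R} (hG : G ⊆ S) {a : R} (ha : a ∈ preorderingGen G) :
    a ∈ S := by
  let T : Subsemiring R :=
    { carrier := S
      mul_mem' := fun ha hb => h.mul _ ha _ hb
      one_mem' := h.one
      add_mem' := fun ha hb => h.add _ ha _ hb
      zero_mem' := h.zero }
  have : Subsemiring.closure (G ∪ {a | ∃ b, a = b ^ 2}) ≤ T := by
    rw [Subsemiring.closure_le]
    rintro x (hx | ⟨b, rfl⟩)
    · exact hG hx
    · exact h.sq b
  exact this ha

end IsCone

lemma cone_real : IsCone {a : ℝ | 0 ≤ a} where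
  add a ha b hb := by
    change 0 ≤ a + b
    exact add_nonneg ha hb
  mul a ha b hb := by
    change 0 ≤ a * b
    exact mul_nonneg ha hb
  total a := by
    rcases le_total 0 a with h | h
    · exact Or.inl h
    · right; change 0 ≤ -a; linarith
  anti a ha hb := by
    change 0 ≤ a at ha
    change 0 ≤ -a at hb
    linarith

/-- Lifting an ordering along a discrete place (Baer-Krull). -/
lemma cone_lift {R F : Type*} [CommRing R] [IsDomain R] [Field F] (φ : R →+* F) (π : R)
    (hπ0 : π ≠ 0)
    (hπ : ∀ r, φ r = 0 ↔ π ∣ r) (hfin : ∀ r : R, r ≠ 0 → FiniteMultiplicity π r)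
    {P : Set F} (hP : IsCone P) :
    ∃ S : Set R, IsCone S ∧ (∀ r, φ r ∈ P → φ r ≠ 0 → r ∈ S) ∧ π ∈ S := by
  refine ⟨{r | r = 0 ∨ ∃ (i : ℕ) (h : R), r = π ^ i * h ∧ φ h ∈ P ∧ φ h ≠ 0}, ?_, ?_, ?_⟩
  · have hφπ : φ π = 0 := (hπ π).2 dvd_rfl
    have key : ∀ (i j : ℕ) (h h' : R), i ≤ j → φ h ∈ P → φ h ≠ 0 → φ h' ∈ P → φ h' ≠ 0 →
        ∃ (l : ℕ) (k : R), π ^ i * h + π ^ j * h' = π ^ l * k ∧ φ k ∈ P ∧ φ k ≠ 0 := by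
      intro i j h h' hij h1 h2 h3 h4
      obtain ⟨d, rfl⟩ := Nat.exists_eq_add_of_le hij
      refine ⟨i, h + π ^ d * h', by ring, ?_⟩
      rcases Nat.eq_zero_or_pos d with rfl | hd
      · simp only [pow_zero, one_mul, map_add]
        refine ⟨hP.add _ h1 _ h3, fun h5 => h2 (hP.anti _ h1 ?_)⟩
        rw [neg_eq_of_add_eq_zero_right h5]; exact h3
      · simp only [map_add, map_mul, map_pow, hφπ, zero_pow hd.ne', zero_mul, add_zero]
        exact ⟨h1, h2⟩
    refine ⟨?_, ?_, ?_, ?_⟩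
    · rintro a (rfl | ⟨i, h, rfl, h1, h2⟩) b (rfl | ⟨j, h', rfl, h3, h4⟩)
      · left; simp
      · right; exact ⟨j, h', by simp, h3, h4⟩
      · right; exact ⟨i, h, by simp, h1, h2⟩
      · right
        rcases le_total i j with hij | hij
        · exact key i j h h' hij h1 h2 h3 h4
        · rw [add_comm]; exact key j i h' h hij h3 h4 h1 h2
    · rintro a (rfl | ⟨i, h, rfl, h1, h2⟩) b (rfl | ⟨j, h', rfl, h3, h4⟩)
      · left; simp
      · left; simp
      · left; simp
      · right
        refine ⟨i + j, h * h', by ring, ?_, ?_⟩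
        · rw [map_mul]; exact hP.mul _ h1 _ h3
        · rw [map_mul]; exact mul_ne_zero h2 h4
    · intro a
      by_cases ha : a = 0
      · left; left; exact ha
      · obtain ⟨c, hc, hc'⟩ := (hfin a ha).exists_eq_pow_mul_and_not_dvd
        have hc0 : φ c ≠ 0 := fun h => hc' ((hπ c).1 h)
        rcases hP.total (φ c) with h | h
        · left; right; exact ⟨_, c, hc, h, hc0⟩
        · right; right; refine ⟨multiplicity π a, -c, ?_, by simpa using h, by simpa using hc0⟩
          rw [mul_neg, ← hc]
    · rintro a (rfl | ⟨i, h, rfl, h1, h2⟩) hb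
      · rfl
      · rcases hb with hb | ⟨j, h', hb, h3, h4⟩
        · simpa using hb
        · exfalso
          have : ∃ (l : ℕ) (k : R), (0 : R) = π ^ l * k ∧ φ k ∈ P ∧ φ k ≠ 0 := by
            have e : (0 : R) = π ^ i * h + π ^ j * h' := by rw [← hb]; ring
            rcases le_total i j with hij | hij
            · rw [e]; exact key i j h h' hij h1 h2 h3 h4
            · rw [e, add_comm]; exact key j i h' h hij h3 h4 h1 h2
          obtain ⟨l, k, hk, -, hk0⟩ := this
          rcases mul_eq_zero.1 hk.symm with h5 | h5
          · exact hπ0 ((pow_ne_zero l hπ0 h5).elim)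
          · exact hk0 (by rw [h5, map_zero])
  · intro r hr hr0
    right; exact ⟨0, r, by simp, hr, hr0⟩
  · right; exact ⟨1, 1, by simp, by simpa using hP.one, by simp⟩

lemma cone_frac {R K : Type*} [CommRing R] [IsDomain R] [Field K] [Algebra R K]
    [IsFractionRing R K] {S : Set R} (hS : IsCone S) :
    ∃ P : Set K, IsCone P ∧ ∀ r, algebraMap R K r ∈ P ↔ r ∈ S := by
  have inj : Function.Injective (algebraMap R K) := IsFractionRing.injective R K
  have sqz : ∀ b : R, b ≠ 0 → (algebraMap R K b) ≠ 0 := fun b hb h => hb (inj (by simpa using h))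
  -- well-definedness
  have wd : ∀ a b c d : R, b ≠ 0 → d ≠ 0 → a * d = c * b → a * b ∈ S → c * d ∈ S := by
    intro a b c d hb hd h hab
    apply hS.cancel (a := b * b) (hS.mul_self b) (mul_ne_zero hb hb)
    have : b * b * (c * d) = (d * d) * (a * b) := by linear_combination (-b * d) * h
    rw [this]
    exact hS.mul _ (hS.mul_self d) _ hab
  let P : Set K := {z | ∃ a b : R, b ≠ 0 ∧ z = algebraMap R K a / algebraMap R K b ∧ a * b ∈ S}
  have char : ∀ a b : R, b ≠ 0 → (algebraMap R K a / algebraMap R K b ∈ P ↔ a * b ∈ S) := by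
    intro a b hb
    constructor
    · rintro ⟨c, d, hd, h, hcd⟩
      refine wd c d a b hd hb ?_ hcd
      apply inj
      rw [div_eq_div_iff (sqz b hb) (sqz d hd)] at h
      rw [map_mul, map_mul, h]
    · intro h
      exact ⟨a, b, hb, rfl, h⟩
  have rep : ∀ z : K, ∃ a b : R, b ≠ 0 ∧ z = algebraMap R K a / algebraMap R K b := by
    intro z
    obtain ⟨a, b, hb, h⟩ := IsFractionRing.div_surjective (A := R) z
    exact ⟨a, b, nonZeroDivisors.ne_zero hb, h.symm⟩
  refine ⟨P, ⟨?_, ?_, ?_, ?_⟩, ?_⟩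
  · rintro _ ⟨a, b, hb, rfl, h1⟩ _ ⟨c, d, hd, rfl, h2⟩
    refine ⟨a * d + b * c, b * d, mul_ne_zero hb hd, ?_, ?_⟩
    · rw [div_add_div _ _ (sqz b hb) (sqz d hd)]; simp
    · have : (a * d + b * c) * (b * d) = (d * d) * (a * b) + (b * b) * (c * d) := by ring
      rw [this]
      exact hS.add _ (hS.mul _ (hS.mul_self d) _ h1) _ (hS.mul _ (hS.mul_self b) _ h2)
  · rintro _ ⟨a, b, hb, rfl, h1⟩ _ ⟨c, d, hd, rfl, h2⟩
    refine ⟨a * c, b * d, mul_ne_zero hb hd, ?_, ?_⟩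
    · rw [div_mul_div_comm]; simp
    · have : (a * c) * (b * d) = (a * b) * (c * d) := by ring
      rw [this]
      exact hS.mul _ h1 _ h2
  · intro z
    obtain ⟨a, b, hb, rfl⟩ := rep z
    rcases hS.total (a * b) with h | h
    · exact Or.inl ⟨a, b, hb, rfl, h⟩
    · refine Or.inr ⟨-a, b, hb, ?_, ?_⟩
      · rw [map_neg, neg_div]
      · rwa [neg_mul]
  · intro z h1 h2
    obtain ⟨a, b, hb, rfl⟩ := rep z
    rw [char a b hb] at h1
    rw [← neg_div, ← map_neg, char _ b hb, neg_mul] at h2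
    have := hS.anti _ h1 h2
    rcases mul_eq_zero.1 this with h | h
    · simp [h]
    · exact absurd h hb
  · intro r
    have := char r 1 one_ne_zero
    simpa using this



/-! ### The ring `ℝ[[x]][[y]]` -/

abbrev R0 : Type := PowerSeries ℝ
abbrev BB : Type := PowerSeries R0
abbrev KK : Type := FractionRing R0

instance : IsAdicComplete (IsLocalRing.maximalIdeal R0) R0 := by
  rw [PowerSeries.maximalIdeal_eq_span_X]
  infer_instance

lemma ps_sqrt {R : Type*} [CommRing R] (h2 : IsUnit (2 : R)) (f : PowerSeries R) (s : R)
    (hs : IsUnit s) (hf : PowerSeries.constantCoeff f = s * s) : ∃ g : PowerSeries R, f = g * g ∧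
      PowerSeries.constantCoeff g = s := by
  have hH : HenselianRing (PowerSeries R) (Ideal.span {PowerSeries.X}) := inferInstance
  have hmem : ∀ a : PowerSeries R, a ∈ Ideal.span {(PowerSeries.X : PowerSeries R)} ↔
      PowerSeries.constantCoeff a = 0 := by
    intro a
    rw [Ideal.mem_span_singleton, PowerSeries.X_dvd_iff]
  obtain ⟨g, hg, hg'⟩ := hH.is_henselian (Polynomial.X ^ 2 - Polynomial.C f)
    (Polynomial.monic_X_pow_sub_C _ two_ne_zero) (PowerSeries.C s)
    (by rw [hmem]; simp [hf, pow_two])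
    (by
      apply IsUnit.map
      have : Polynomial.eval (PowerSeries.C s)
          (Polynomial.derivative (Polynomial.X ^ 2 - Polynomial.C f)) = PowerSeries.C (2 * s) := by
        rw [map_mul, map_ofNat]
        simp [one_add_one_eq_two]
      rw [this]
      exact (h2.mul hs).map _)
  refine ⟨g, ?_, ?_⟩
  · have : g ^ 2 - f = 0 := by simpa [Polynomial.IsRoot] using hg
    linear_combination -this
  · rw [hmem] at hg'
    have : PowerSeries.constantCoeff g - s = 0 := by simpa using hg'
    linear_combination this

lemma real_sqrt_unit (c : ℝ) (hc : 0 < c) : ∃ s : ℝ, IsUnit s ∧ c = s * s :=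
  ⟨Real.sqrt c, (Real.sqrt_pos.2 hc).ne'.isUnit, (Real.mul_self_sqrt hc.le).symm⟩

lemma isUnit_two_real : IsUnit (2 : ℝ) := (two_ne_zero).isUnit

lemma isUnit_two_R0 : IsUnit (2 : R0) := by
  have := isUnit_two_real.map (PowerSeries.C (R := ℝ))
  rwa [map_ofNat] at this

/-- positive series are squares of units -/
lemma R0_sqrt (f : R0) (hf : 0 < PowerSeries.constantCoeff f) : ∃ g : R0, IsUnit g ∧ f = g * g := by
  obtain ⟨s, hs, h⟩ := real_sqrt_unit _ hf
  obtain ⟨g, hg, hg'⟩ := ps_sqrt isUnit_two_real f s hs h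
  exact ⟨g, by rw [PowerSeries.isUnit_iff_constantCoeff, hg']; exact hs, hg⟩

lemma R0_unit (f : R0) (hf : IsUnit f) : ∃ g : R0, IsUnit g ∧ (f = g * g ∨ f = -(g * g)) := by
  have h0 : PowerSeries.constantCoeff f ≠ 0 := by
    rw [PowerSeries.isUnit_iff_constantCoeff] at hf
    exact hf.ne_zero
  rcases lt_or_gt_of_ne h0 with h | h
  · obtain ⟨g, hg, h1⟩ := R0_sqrt (-f) (by simpa using h)
    exact ⟨g, hg, Or.inr (by rw [← h1, neg_neg])⟩
  · obtain ⟨g, hg, h1⟩ := R0_sqrt f h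
    exact ⟨g, hg, Or.inl h1⟩

lemma BB_unit (f : BB) (hf : IsUnit f) : ∃ g : BB, IsUnit g ∧ (f = g * g ∨ f = -(g * g)) := by
  rw [PowerSeries.isUnit_iff_constantCoeff] at hf
  obtain ⟨s, hs, h | h⟩ := R0_unit _ hf
  · obtain ⟨g, hg, hg'⟩ := ps_sqrt isUnit_two_R0 f s hs h
    exact ⟨g, by rw [PowerSeries.isUnit_iff_constantCoeff, hg']; exact hs, Or.inl hg⟩
  · obtain ⟨g, hg, hg'⟩ := ps_sqrt isUnit_two_R0 (-f) s hs (by rw [map_neg, h, neg_neg])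
    exact ⟨g, by rw [PowerSeries.isUnit_iff_constantCoeff, hg']; exact hs,
      Or.inr (by rw [← hg, neg_neg])⟩

lemma R0_factor (a : R0) (ha : a ≠ 0) : ∃ (m : ℕ) (v : R0), IsUnit v ∧ a = PowerSeries.X ^ m * v := by
  obtain ⟨m, h⟩ := IsDiscreteValuationRing.associated_pow_irreducible ha
    (PowerSeries.X_prime (R := ℝ)).irreducible
  obtain ⟨u, hu⟩ := h.symm
  exact ⟨m, u, u.isUnit, hu.symm⟩

/-! ### The isomorphism `ℝ[[x,y]] ≃ ℝ[[x]][[y]]` -/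

def psMapEquiv {R S : Type*} [CommRing R] [CommRing S] (e : R ≃+* S) :
    PowerSeries R ≃+* PowerSeries S :=
  RingEquiv.ofRingHom (PowerSeries.map e.toRingHom) (PowerSeries.map e.symm.toRingHom)
    (by ext f n; simp) (by ext f n; simp)

lemma exists_iso : ∃ Φ : PS ≃+* BB, Φ psX = PowerSeries.C PowerSeries.X ∧ Φ psY = PowerSeries.X := by
  let e1 : PS ≃ₐ[ℝ] PS := MvPowerSeries.renameEquiv ℝ (Equiv.swap (0 : Fin 2) 1)
  let e2 : PS ≃ₐ[ℝ] PowerSeries (MvPowerSeries (Fin 1) ℝ) := MvPowerSeries.finSuccEquiv ℝ 1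
  let e3 : MvPowerSeries (Fin 1) ℝ ≃ₐ[ℝ] MvPowerSeries Unit ℝ :=
    MvPowerSeries.renameEquiv ℝ (Equiv.ofUnique (Fin 1) Unit)
  let e4 : PowerSeries (MvPowerSeries (Fin 1) ℝ) ≃+* BB := psMapEquiv e3.toRingEquiv
  refine ⟨(e1.toRingEquiv.trans e2.toRingEquiv).trans e4, ?_, ?_⟩
  · have h1 : e1 (MvPowerSeries.X 0) = MvPowerSeries.X 1 := by simp [e1]
    have h2 : e2 (MvPowerSeries.X 1) = PowerSeries.C (MvPowerSeries.X 0) :=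
      MvPowerSeries.finSuccEquiv_X_succ (0 : Fin 1)
    have h3 : e3 (MvPowerSeries.X 0) = (PowerSeries.X : R0) := by
      simp [e3]; rfl
    have h4 : e4 (PowerSeries.C (MvPowerSeries.X 0)) = PowerSeries.C (e3 (MvPowerSeries.X 0)) := by
      simp [e4, psMapEquiv]
    change e4 (e2 (e1 (MvPowerSeries.X 0))) = _
    rw [h1, h2, h4, h3]
  · have h1 : e1 (MvPowerSeries.X 1) = MvPowerSeries.X 0 := by simp [e1]
    have h2 : e2 (MvPowerSeries.X 0) = PowerSeries.X :=
      MvPowerSeries.finSuccEquiv_X_zero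
    have h4 : e4 PowerSeries.X = PowerSeries.X := by
      simp [e4, psMapEquiv]
    change e4 (e2 (e1 (MvPowerSeries.X 1))) = _
    rw [h1, h2, h4]

/-- the generators in `ℝ[[x]][[y]]` -/
abbrev bx : BB := PowerSeries.C PowerSeries.X
abbrev bY : BB := PowerSeries.X

/-- the preordering -/
def TT (n : ℕ) : Subsemiring BB :=
  Subsemiring.closure ({bx, bY, bx ^ n - bY} ∪ {a | ∃ b, a = b ^ 2})

lemma TT_x (n : ℕ) : bx ∈ TT n := Subsemiring.subset_closure (by simp)
lemma TT_y (n : ℕ) : bY ∈ TT n := Subsemiring.subset_closure (by simp)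
lemma TT_z (n : ℕ) : bx ^ n - bY ∈ TT n := Subsemiring.subset_closure (by simp)
lemma TT_sq (n : ℕ) (a : BB) : a * a ∈ TT n :=
  Subsemiring.subset_closure (Or.inr ⟨a, (pow_two a).symm⟩)

/-- reduction to `ℝ[[x]][[y]]` -/
lemma reduction (n : ℕ)
    (main : ∀ f : BB, (∀ S : Set BB, IsCone S → bx ∈ S → bY ∈ S → bx ^ n - bY ∈ S → f ∈ S) →
      f ∈ TT n) (f : PS)
    (hf : ∀ P : Set FF, IsOrderingF P → (ι psX ∈ P ∧ ι psX ≠ 0) →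
      (ι psY ∈ P ∧ ι psY ≠ 0) →
      (ι (psX ^ n - psY) ∈ P ∧ ι (psX ^ n - psY) ≠ 0) → ι f ∈ P) :
    f ∈ preorderingGen {psX, psY, psX ^ n - psY} := by
  obtain ⟨Φ, hx, hy⟩ := exists_iso
  have hz : Φ (psX ^ n - psY) = bx ^ n - bY := by rw [map_sub, map_pow, hx, hy]
  have hT : Φ f ∈ TT n := by
    apply main
    intro S hS h1 h2 h3
    obtain ⟨P, hP, hP'⟩ := cone_frac (K := FF) (hS.comap Φ.toRingHom Φ.injective)
    have key : ∀ a : PS, ι a ∈ P ↔ Φ a ∈ S := hP'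
    have inj : ∀ a : PS, Φ a ≠ 0 → ι a ≠ 0 := by
      intro a ha h
      apply ha
      have : a = 0 := (IsFractionRing.injective PS FF) (by simpa using h)
      rw [this, map_zero]
    rw [← key]
    refine hf P ⟨hP.add, hP.mul, hP.total, hP.anti⟩ ⟨?_, ?_⟩ ⟨?_, ?_⟩ ⟨?_, ?_⟩
    · rw [key, hx]; exact h1
    · apply inj; rw [hx]
      intro h
      exact PowerSeries.X_ne_zero (PowerSeries.C_injective (by rw [h, map_zero]))
    · rw [key, hy]; exact h2
    · apply inj; rw [hy]; exact PowerSeries.X_ne_zero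
    · rw [key, hz]; exact h3
    · apply inj; rw [hz]
      intro h
      have := congrArg (PowerSeries.coeff 1) h
      rw [map_sub, ← map_pow, PowerSeries.coeff_C] at this
      simp at this
  have hle : TT n ≤ (Subsemiring.closure ({psX, psY, psX ^ n - psY} ∪ {a | ∃ b, a = b ^ 2})).map
      Φ.toRingHom := by
    rw [TT, Subsemiring.closure_le]
    rintro a ((rfl | rfl | rfl) | ⟨b, rfl⟩)
    · exact ⟨psX, Subsemiring.subset_closure (by simp), hx⟩
    · exact ⟨psY, Subsemiring.subset_closure (by simp), hy⟩
    · exact ⟨psX ^ n - psY, Subsemiring.subset_closure (by simp), hz⟩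
    · refine ⟨Φ.symm b ^ 2, Subsemiring.subset_closure (Or.inr ⟨_, rfl⟩), ?_⟩
      change Φ _ = _
      simp
  obtain ⟨g, hg, hg'⟩ := hle hT
  have : g = f := Φ.injective hg'
  rw [← this]
  exact hg



/-! ### Hensel-type consequences of Weierstrass preparation -/

lemma R0_mem_max (a : R0) : a ∈ IsLocalRing.maximalIdeal R0 ↔ PowerSeries.X ∣ a := by
  rw [PowerSeries.maximalIdeal_eq_span_X, Ideal.mem_span_singleton]

lemma dist_dvd {R : Type*} [CommRing R] {I : Ideal R} [IsAdicComplete I R] {D g : Polynomial R} (hD : D.IsDistinguishedAt I)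
    (h : (D : (PowerSeries R)) ∣ (g : (PowerSeries R))) : D ∣ g := by
  rw [← Ideal.mem_span_singleton, ← Ideal.Quotient.eq_zero_iff_mem]
  apply hD.algEquivQuotient.injective
  rw [map_zero]
  have : hD.algEquivQuotient (Ideal.Quotient.mk _ g) = Ideal.Quotient.mk _ (g : (PowerSeries R)) := by
    simp
  rw [this, Ideal.Quotient.eq_zero_iff_mem, Ideal.mem_span_singleton]
  exact h

/-- evaluation of power series at a root of a distinguished polynomial -/
lemma dist_eval {R : Type*} [CommRing R] {I : Ideal R} [IsAdicComplete I R] {q : Polynomial R} (hq : q.IsDistinguishedAt I)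
    {A : Type*} [CommRing A] [Algebra R A] (a : A) (ha : Polynomial.aeval a q = 0) :
    ∃ ψ : (PowerSeries R) →+* A, (∀ g : Polynomial R, ψ (g : (PowerSeries R)) = Polynomial.aeval a g) ∧
      ((∀ g : Polynomial R, Polynomial.aeval a g = 0 → q ∣ g) →
        ∀ b : (PowerSeries R), ψ b = 0 ↔ (q : (PowerSeries R)) ∣ b) := by
  let e := hq.algEquivQuotient
  let l : (Polynomial R ⧸ Ideal.span {q}) →+* A := Ideal.Quotient.lift (Ideal.span {q})
    (Polynomial.aeval a).toRingHom (by
      intro g hg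
      rw [Ideal.mem_span_singleton] at hg
      obtain ⟨c, rfl⟩ := hg
      simp [ha])
  let ψ : (PowerSeries R) →+* A := (l.comp e.symm.toRingEquiv.toRingHom).comp (Ideal.Quotient.mk _)
  have hψ : ∀ g : Polynomial R, ψ (g : (PowerSeries R)) = Polynomial.aeval a g := by
    intro g
    have h1 : e (Ideal.Quotient.mk _ g) = Ideal.Quotient.mk _ (g : (PowerSeries R)) := by
      simp [e]
    have h2 : e.symm (Ideal.Quotient.mk _ (g : (PowerSeries R))) = Ideal.Quotient.mk _ g := by
      rw [← h1, AlgEquiv.symm_apply_apply]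
    change l (e.symm (Ideal.Quotient.mk _ (g : (PowerSeries R)))) = _
    rw [h2]
    simp [l]
  refine ⟨ψ, hψ, ?_⟩
  intro hker b
  constructor
  · intro hb
    obtain ⟨g, hg⟩ := Ideal.Quotient.mk_surjective (e.symm (Ideal.Quotient.mk _ b))
    have h1 : (Ideal.Quotient.mk (Ideal.span {(q : (PowerSeries R))}) b) = Ideal.Quotient.mk _ (g : (PowerSeries R)) := by
      have : e (Ideal.Quotient.mk _ g) = Ideal.Quotient.mk _ (g : (PowerSeries R)) := by
        simp [e]
      rw [← this, hg, AlgEquiv.apply_symm_apply]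
    have h2 : Polynomial.aeval a g = 0 := by
      rw [← hψ, ← hb]
      change l (e.symm (Ideal.Quotient.mk _ (g : (PowerSeries R)))) = l (e.symm (Ideal.Quotient.mk _ b))
      rw [h1]
    obtain ⟨c, rfl⟩ := hker g h2
    rw [← Ideal.mem_span_singleton, ← Ideal.Quotient.eq_zero_iff_mem, h1,
      Ideal.Quotient.eq_zero_iff_mem, Ideal.mem_span_singleton, Polynomial.coe_mul]
    exact dvd_mul_right _ _
  · rintro ⟨c, rfl⟩
    rw [map_mul, hψ, ha, zero_mul]

lemma weier_poly (g : Polynomial R0) (j : ℕ) (hj : IsUnit (g.coeff j))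
    (h0 : ¬ IsUnit (g.coeff 0)) :
    ∃ D : Polynomial R0, D.IsDistinguishedAt (IsLocalRing.maximalIdeal R0) ∧ D ∣ g ∧
      0 < D.natDegree ∧ D.natDegree ≤ j := by
  have hc : PowerSeries.coeff j ((g : BB).map (IsLocalRing.residue R0)) ≠ 0 := by
    rw [PowerSeries.coeff_map, Polynomial.coeff_coe]
    exact (hj.map _).ne_zero
  have hne : (g : BB).map (IsLocalRing.residue R0) ≠ 0 := by
    intro h
    rw [h] at hc
    simp at hc
  obtain ⟨D, h, H⟩ := PowerSeries.exists_isWeierstrassFactorization hne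
  refine ⟨D, H.isDistinguishedAt, dist_dvd H.isDistinguishedAt ⟨h, H.eq_mul⟩, ?_, ?_⟩
  · rw [Nat.pos_iff_ne_zero]
    intro h1
    have h2 := H.isDistinguishedAt.monic.natDegree_eq_zero.1 h1
    apply h0
    have h3 := H.eq_mul
    rw [h2, Polynomial.coe_one, one_mul] at h3
    have h4 := H.isUnit
    rw [PowerSeries.isUnit_iff_constantCoeff, ← h3] at h4
    simpa using h4
  · rw [H.natDegree_eq_toNat_order_map]
    have := PowerSeries.order_le j hc
    exact ENat.toNat_le_of_le_natCast this

lemma poly_factor_X (g : Polynomial R0) (hg : g ≠ 0) :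
    ∃ (s : ℕ) (g' : Polynomial R0), g = Polynomial.C (PowerSeries.X ^ s) * g' ∧
      ∃ j, IsUnit (g'.coeff j) := by
  have hnu : ¬ IsUnit (Polynomial.C (PowerSeries.X : R0)) := by
    rw [Polynomial.isUnit_C]
    exact PowerSeries.X_prime.not_isUnit
  obtain ⟨c, hc, hc'⟩ := (FiniteMultiplicity.of_not_isUnit hnu hg).exists_eq_pow_mul_and_not_dvd
  refine ⟨_, c, by rw [map_pow]; exact hc, ?_⟩
  rw [Polynomial.C_dvd_iff_dvd_coeff] at hc'
  push Not at hc'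
  obtain ⟨j, hj⟩ := hc'
  refine ⟨j, ?_⟩
  rw [← R0_mem_max] at hj
  exact IsLocalRing.notMem_maximalIdeal.1 hj

lemma dist_of_irreducible (q : Polynomial R0) (hm : q.Monic) (hi : Irreducible q)
    (h0 : ¬ IsUnit (q.coeff 0)) : q.IsDistinguishedAt (IsLocalRing.maximalIdeal R0) := by
  obtain ⟨D, hD, ⟨c, hc⟩, hpos, -⟩ := weier_poly q q.natDegree (by simp [hm]) h0
  have hDu : ¬ IsUnit D := by
    intro h
    have := hD.monic.eq_one_of_isUnit h
    rw [this] at hpos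
    simp at hpos
  have hcu := (hi.isUnit_or_isUnit hc).resolve_left hDu
  have : D = q := by
    apply Polynomial.eq_of_monic_of_associated hD.monic hm
    rw [hc]
    exact (associated_mul_unit_right D c hcu)
  rw [← this]; exact hD

/-- an irreducible polynomial over the fraction field has, after normalisation, a unit leading
or constant coefficient -/
lemma irreducible_normal (q : Polynomial KK) (hi : Irreducible q) :
    ∃ (g : Polynomial R0) (β : KK), β ≠ 0 ∧ g.map (algebraMap R0 KK) = Polynomial.C β * q ∧
      (IsUnit g.leadingCoeff ∨ IsUnit (g.coeff 0)) := by
  have inj : Function.Injective (algebraMap R0 KK) := IsFractionRing.injective R0 KK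
  obtain ⟨b, hb0, hb⟩ := IsLocalization.integerNormalization_spec (nonZeroDivisors R0) q
  set g0 := IsLocalization.integerNormalization (nonZeroDivisors R0) q
  have hbne : algebraMap R0 KK b ≠ 0 := by
    intro h
    exact nonZeroDivisors.ne_zero hb0 (inj (by rw [h, map_zero]))
  have hb' : g0.map (algebraMap R0 KK) = Polynomial.C (algebraMap R0 KK b) * q := by
    rw [hb, ← IsScalarTower.algebraMap_smul KK b q, Polynomial.smul_eq_C_mul]
  have hg0 : g0 ≠ 0 := by
    intro h
    rw [h, Polynomial.map_zero] at hb'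
    exact mul_ne_zero (Polynomial.C_ne_zero.2 hbne) hi.ne_zero hb'.symm
  obtain ⟨s, g, hg, j, hj⟩ := poly_factor_X g0 hg0
  have hXne : algebraMap R0 KK (PowerSeries.X ^ s) ≠ 0 := by
    intro h
    exact pow_ne_zero s (PowerSeries.X_ne_zero (R := ℝ)) (inj (by rw [h, map_zero]))
  have hgq : g.map (algebraMap R0 KK) =
      Polynomial.C ((algebraMap R0 KK (PowerSeries.X ^ s))⁻¹ * algebraMap R0 KK b) * q := by
    rw [map_mul, mul_assoc, ← hb', hg, Polynomial.map_mul, Polynomial.map_C, ← mul_assoc,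
      ← map_mul, inv_mul_cancel₀ hXne, map_one, one_mul]
  have hβ : (algebraMap R0 KK (PowerSeries.X ^ s))⁻¹ * algebraMap R0 KK b ≠ 0 :=
    mul_ne_zero (inv_ne_zero hXne) hbne
  refine ⟨g, _, hβ, hgq, ?_⟩
  by_contra! hcon
  obtain ⟨hlead, hconst⟩ := hcon
  obtain ⟨D, hD, hDg, hpos, hle⟩ := weier_poly g j hj hconst
  have hjle : j ≤ g.natDegree := Polynomial.le_natDegree_of_ne_zero hj.ne_zero
  have hjlt : j < g.natDegree := by
    refine lt_of_le_of_ne hjle ?_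
    rintro rfl
    exact hlead hj
  have hgi : Irreducible (g.map (algebraMap R0 KK)) := by
    rw [hgq]
    rw [irreducible_isUnit_mul (Polynomial.isUnit_C.2 hβ.isUnit)]
    exact hi
  obtain ⟨c, rfl⟩ := hDg
  rw [Polynomial.map_mul] at hgi
  have hg' : D * c ≠ 0 := by
    intro h
    rw [h] at hj
    simp at hj
  have hdeg := Polynomial.natDegree_mul (left_ne_zero_of_mul hg') (right_ne_zero_of_mul hg')
  rcases hgi.isUnit_or_isUnit rfl with h | h
  · have := Polynomial.natDegree_eq_zero_of_isUnit h
    rw [Polynomial.natDegree_map_eq_of_injective inj] at this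
    omega
  · have := Polynomial.natDegree_eq_zero_of_isUnit h
    rw [Polynomial.natDegree_map_eq_of_injective inj] at this
    omega


/-! ### Finite extensions of `ℝ((x))` -/

section FiniteExt

variable {L : Type*} [Field L] [Algebra R0 L] [Algebra KK L] [IsScalarTower R0 KK L]
  [FiniteDimensional KK L]

lemma int_or_inv (a : L) : IsIntegral R0 a ∨ IsIntegral R0 a⁻¹ := by
  obtain ⟨g, β, hβ, hg, h⟩ := irreducible_normal (minpoly KK a)
    (minpoly.irreducible (IsIntegral.of_finite KK a))
  have hag : Polynomial.eval₂ (algebraMap R0 L) a g = 0 := by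
    rw [← Polynomial.aeval_def, ← Polynomial.aeval_map_algebraMap KK, hg, map_mul,
      minpoly.aeval, mul_zero]
  have key : ∀ (g : Polynomial R0) (a : L), Polynomial.eval₂ (algebraMap R0 L) a g = 0 →
      IsUnit g.leadingCoeff → IsIntegral R0 a := by
    intro g a h hu
    obtain ⟨v, hv⟩ := hu.exists_left_inv
    refine ⟨Polynomial.C v * g, Polynomial.monic_C_mul_of_mul_leadingCoeff_eq_one hv, ?_⟩
    rw [Polynomial.eval₂_mul, h, mul_zero]
  rcases h with h | h
  · exact Or.inl (key g a hag h)
  · right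
    refine key g.reverse a⁻¹ ?_ ?_
    · by_cases ha : a = 0
      · exfalso
        rw [ha, Polynomial.eval₂_at_zero] at hag
        exact (h.map (algebraMap R0 L)).ne_zero hag
      · let _ := invertibleOfNonzero ha
        have := (Polynomial.eval₂_reverse_eq_zero_iff (algebraMap R0 L) a g).2 hag
        rwa [invOf_eq_inv] at this
    · rw [Polynomial.reverse_leadingCoeff, Polynomial.trailingCoeff,
        Polynomial.natTrailingDegree_eq_zero.2 (Or.inr h.ne_zero)]
      exact h

def IsSmall (t : L) : Prop := IsIntegral R0 t ∧ ¬ IsIntegral R0 t⁻¹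

lemma small_minpoly (t : L) (ht : IsSmall t) :
    (minpoly R0 t).IsDistinguishedAt (IsLocalRing.maximalIdeal R0) := by
  have inj : Function.Injective (algebraMap R0 L) := by
    rw [IsScalarTower.algebraMap_eq R0 KK L]
    exact (algebraMap KK L).injective.comp (IsFractionRing.injective R0 KK)
  apply dist_of_irreducible _ (minpoly.monic ht.1) (minpoly.irreducible ht.1)
  intro hu
  apply ht.2
  have h1 : t * Polynomial.aeval t (minpoly R0 t).divX +
      algebraMap R0 L ((minpoly R0 t).coeff 0) = 0 := by
    have h := congrArg (Polynomial.aeval t) (Polynomial.X_mul_divX_add (minpoly R0 t))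
    rw [minpoly.aeval, map_add, map_mul, Polynomial.aeval_X, Polynomial.aeval_C] at h
    exact h
  obtain ⟨v, hv⟩ := hu.exists_left_inv
  have h2 : algebraMap R0 L v * algebraMap R0 L ((minpoly R0 t).coeff 0) = 1 := by
    rw [← map_mul, hv, map_one]
  have ht0 : t ≠ 0 := by
    rintro rfl
    exact ht.2 (by rw [inv_zero]; exact isIntegral_zero)
  have h3 : t⁻¹ = - algebraMap R0 L v * Polynomial.aeval t (minpoly R0 t).divX := by
    rw [inv_eq_iff_eq_inv, eq_comm, inv_eq_iff_eq_inv, eq_comm]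
    apply inv_eq_of_mul_eq_one_right
    linear_combination (- algebraMap R0 L v) * h1 + h2
  rw [h3]
  refine IsIntegral.mul (isIntegral_algebraMap.neg) ?_
  rw [Polynomial.aeval_eq_sum_range]
  refine IsIntegral.sum _ fun i _ => ?_
  exact (ht.1.pow i).smul _

lemma small_sqrt (t : L) (ht : IsSmall t) : ∃ s : L, 1 + t = s * s := by
  obtain ⟨ψ, hψ, -⟩ := dist_eval (small_minpoly t ht) t (minpoly.aeval R0 t)
  obtain ⟨g, hg, -⟩ := ps_sqrt isUnit_two_R0 ((1 + Polynomial.X : Polynomial R0) : PowerSeries R0) 1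
    isUnit_one (by simp)
  refine ⟨ψ g, ?_⟩
  rw [← map_mul, ← hg, hψ]
  simp

lemma not_small_iff (t : L) (ht : ¬ IsSmall t) (hi : IsIntegral R0 t) : IsIntegral R0 t⁻¹ := by
  by_contra h
  exact ht ⟨hi, h⟩

lemma R0_L_inj : Function.Injective (algebraMap R0 L) := by
  rw [IsScalarTower.algebraMap_eq R0 KK L]
  exact (algebraMap KK L).injective.comp (IsFractionRing.injective R0 KK)

instance : CharZero R0 := charZero_of_injective_algebraMap (algebraMap ℝ R0).injective

instance : CharZero KK := charZero_of_injective_algebraMap (IsFractionRing.injective R0 KK)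

lemma X_small : IsSmall (algebraMap R0 L PowerSeries.X) := by
  refine ⟨isIntegral_algebraMap, fun h => ?_⟩
  have h1 : IsIntegral R0 ((algebraMap R0 KK PowerSeries.X)⁻¹) := by
    have : algebraMap KK L ((algebraMap R0 KK PowerSeries.X)⁻¹) =
        (algebraMap R0 L PowerSeries.X)⁻¹ := by
      rw [map_inv₀, ← IsScalarTower.algebraMap_apply]
    rw [← this] at h
    exact (isIntegral_algebraMap_iff (algebraMap KK L).injective).1 h
  obtain ⟨w, hw⟩ := IsIntegrallyClosed.isIntegral_iff.1 h1
  have hX : algebraMap R0 KK PowerSeries.X ≠ 0 := by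
    intro h
    exact PowerSeries.X_ne_zero (IsFractionRing.injective R0 KK (by rw [h, map_zero]))
  have h2 : algebraMap R0 KK (w * PowerSeries.X) = algebraMap R0 KK 1 := by
    rw [map_mul, hw, inv_mul_cancel₀ hX, map_one]
  have h3 := IsFractionRing.injective R0 KK h2
  exact PowerSeries.X_prime.not_isUnit (IsUnit.of_mul_eq_one_right w h3)

lemma oL_isUnit (a : integralClosure R0 L) (ha : a ≠ 0) :
    IsUnit a ↔ ¬ IsSmall (a : L) := by
  have ha' : (a : L) ≠ 0 := fun h => ha (Subtype.ext h)
  constructor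
  · intro h hs
    obtain ⟨b, hb⟩ := h.exists_right_inv
    apply hs.2
    have : (a : L)⁻¹ = b := inv_eq_of_mul_eq_one_right (by exact_mod_cast congrArg Subtype.val hb)
    rw [this]
    exact b.2
  · intro h
    have := not_small_iff _ h a.2
    refine IsUnit.of_mul_eq_one ⟨(a : L)⁻¹, this⟩ (Subtype.ext ?_)
    exact mul_inv_cancel₀ ha'

lemma oL_dvr : IsDiscreteValuationRing (integralClosure R0 L) := by
  have hF : IsFractionRing (integralClosure R0 L) L :=
    integralClosure.isFractionRing_of_finite_extension KK L
  have hV : ValuationRing (integralClosure R0 L) := by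
    rw [ValuationRing.iff_isInteger_or_isInteger _ L]
    intro x
    rcases int_or_inv x with h | h
    · exact Or.inl ⟨⟨x, h⟩, rfl⟩
    · exact Or.inr ⟨⟨x⁻¹, h⟩, rfl⟩
  have hD : IsDedekindDomain (integralClosure R0 L) := integralClosure.isDedekindDomain R0 KK L
  have hnf : ¬ IsField (integralClosure R0 L) := by
    intro h
    have h0 : (⟨algebraMap R0 L PowerSeries.X, X_small.1⟩ : integralClosure R0 L) ≠ 0 := by
      intro h
      have := congrArg Subtype.val h
      exact PowerSeries.X_ne_zero (R0_L_inj (L := L) (by simpa using this))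
    obtain ⟨b, hb⟩ := h.mul_inv_cancel h0
    exact (oL_isUnit _ h0).1 (IsUnit.of_mul_eq_one _ hb) X_small
  exact ((IsDiscreteValuationRing.TFAE (integralClosure R0 L) hnf).out 0 2).2 hD

lemma L_dich_aux (k : Type*) [Field k] (φ : integralClosure R0 L →+* k)
    (hφ : ∀ a, φ a = 0 ↔ (a = 0 ∨ IsSmall (a : L))) (hsurj : Function.Surjective φ) :
    (∃ i : k, i * i = -1) ∨ ∃ e : k ≃+* ℝ, ∀ c : ℝ, 
      e (φ (algebraMap R0 _ (PowerSeries.C c))) = c := by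
  let ρ : ℝ →+* k := (φ.comp (algebraMap R0 (integralClosure R0 L))).comp PowerSeries.C
  let _ : Algebra ℝ k := ρ.toAlgebra
  have hX : φ (algebraMap R0 _ PowerSeries.X) = 0 := by
    rw [hφ]
    exact Or.inr (X_small (L := L))
  have hc : ∀ r : R0, φ (algebraMap R0 _ r) = ρ (PowerSeries.constantCoeff r) := by
    intro r
    have h1 := PowerSeries.eq_X_mul_shift_add_const r
    conv_lhs => rw [h1]
    rw [map_add, map_mul, map_add, map_mul, hX, zero_mul, zero_add]
    rfl
  have hc' : φ.comp (algebraMap R0 (integralClosure R0 L)) = ρ.comp PowerSeries.constantCoeff :=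
    RingHom.ext hc
  have halg : Algebra.IsAlgebraic ℝ k := by
    refine ⟨fun b => ?_⟩
    obtain ⟨a, rfl⟩ := hsurj b
    obtain ⟨q, hq, hqa⟩ := a.2
    have hqa' : Polynomial.eval₂ (algebraMap R0 (integralClosure R0 L)) a q = 0 := by
      have := Polynomial.hom_eval₂ q (algebraMap R0 (integralClosure R0 L))
        (integralClosure R0 L).val.toRingHom a
      apply Subtype.ext
      exact this.trans hqa
    have hIntg : IsIntegral ℝ (φ a) := by
      refine ⟨q.map PowerSeries.constantCoeff, hq.map _, ?_⟩
      rw [Polynomial.eval₂_map]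
      change Polynomial.eval₂ (ρ.comp PowerSeries.constantCoeff) _ _ = 0
      rw [← hc', ← Polynomial.hom_eval₂, hqa', map_zero]
    exact hIntg.isAlgebraic
  rcases Real.nonempty_algEquiv_or k with ⟨⟨e⟩⟩ | ⟨⟨e⟩⟩
  · right
    refine ⟨e.toRingEquiv, fun c => ?_⟩
    exact e.commutes c
  · left
    refine ⟨e.symm Complex.I, ?_⟩
    rw [← map_mul, Complex.I_mul_I, map_neg, map_one]

variable (L) in
lemma L_dich : (∃ s : L, -1 = s * s) ∨ ∃ u : L, u ≠ 0 ∧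
    (∀ a : L, a ≠ 0 → ∃ s : L, s ≠ 0 ∧ (a = s * s ∨ a = -(s * s) ∨ a = u * (s * s) ∨
      a = -(u * (s * s)))) ∧
    (∀ t : L, IsIntegral R0 t → IsIntegral R0 t⁻¹ → ∃ s : L, t = s * s ∨ t = -(s * s)) ∧
    (∃ P : Set L, IsCone P ∧ u ∈ P) ∧ (∃ P : Set L, IsCone P ∧ -u ∈ P) := by
  have hF : IsFractionRing (integralClosure R0 L) L :=
    integralClosure.isFractionRing_of_finite_extension KK L
  have hdvr : IsDiscreteValuationRing (integralClosure R0 L) := oL_dvr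
  let k := IsLocalRing.ResidueField (integralClosure R0 L)
  let φ : integralClosure R0 L →+* k := IsLocalRing.residue _
  have hφ : ∀ a, φ a = 0 ↔ (a = 0 ∨ IsSmall (a : L)) := by
    intro a
    rw [IsLocalRing.residue_eq_zero_iff, IsLocalRing.mem_maximalIdeal, mem_nonunits_iff]
    by_cases ha : a = 0
    · simp [ha]
    · rw [oL_isUnit a ha]; simp [ha]
  have hφs : Function.Surjective φ := IsLocalRing.residue_surjective
  have h1s : ∀ a, φ a = 0 → ∃ s : L, 1 + (a : L) = s * s := by
    intro a ha
    rcases (hφ a).1 ha with rfl | h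
    · exact ⟨1, by simp⟩
    · exact small_sqrt _ h
  rcases L_dich_aux k φ hφ hφs with ⟨i, hi⟩ | ⟨e, he⟩
  · left
    obtain ⟨j, rfl⟩ := hφs i
    obtain ⟨s, hs⟩ := h1s (-(j * j) - 1) (by
      rw [map_sub, map_neg, map_mul, hi, map_one]; ring)
    have hj : (j : L) ≠ 0 := by
      intro h
      have : j = 0 := Subtype.ext h
      rw [this] at hi
      simp at hi
    refine ⟨s / j, ?_⟩
    field_simp
    push_cast at hs
    linear_combination hs
  · right
    have hunit : ∀ t : L, IsIntegral R0 t → IsIntegral R0 t⁻¹ →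
        ∃ s : L, t = s * s ∨ t = -(s * s) := by
      intro t h1 h2
      by_cases ht0 : t = 0
      · exact ⟨0, by simp [ht0]⟩
      have key : ∀ t : L, t ≠ 0 → ∀ (h1 : IsIntegral R0 t), IsIntegral R0 t⁻¹ →
          0 < e (φ ⟨t, h1⟩) → ∃ s : L, t = s * s := by
        intro t ht0 h1 h2 hpos
        obtain ⟨c, hc, hcc⟩ := real_sqrt_unit _ hpos
        let d : integralClosure R0 L := algebraMap R0 _ (PowerSeries.C c⁻¹)
        have hd0 : (d : L) ≠ 0 := by
          intro h
          have h3 : d = 0 := Subtype.ext h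
          have h4 := he c⁻¹
          change e (φ d) = _ at h4
          rw [h3, map_zero, map_zero] at h4
          exact inv_ne_zero hc.ne_zero h4.symm
        obtain ⟨s, hs⟩ := h1s (⟨t, h1⟩ * (d * d) - 1) (by
          apply e.injective
          rw [map_sub, map_sub, map_mul, map_mul, map_mul, map_mul, he, map_one, map_one, map_zero,
            hcc]
          have := hc.ne_zero
          field_simp
          simp)
        refine ⟨s / d, ?_⟩
        push_cast at hs
        field_simp
        linear_combination hs
      have hne : e (φ ⟨t, h1⟩) ≠ 0 := by
        intro h
        have h3 : φ ⟨t, h1⟩ = 0 := by simpa using h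
        rcases (hφ _).1 h3 with h4 | h4
        · exact ht0 (congrArg Subtype.val h4)
        · exact h4.2 h2
      rcases lt_or_gt_of_ne hne with h | h
      · obtain ⟨s, hs⟩ := key (-t) (neg_ne_zero.2 ht0) h1.neg (by rw [inv_neg]; exact h2.neg) (by
          have : (⟨-t, h1.neg⟩ : integralClosure R0 L) = -⟨t, h1⟩ := rfl
          rw [this, map_neg, map_neg]
          linarith)
        exact ⟨s, Or.inr (by rw [← hs, neg_neg])⟩
      · obtain ⟨s, hs⟩ := key t ht0 h1 h2 h
        exact ⟨s, Or.inl hs⟩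
    obtain ⟨π, hπ⟩ := IsDiscreteValuationRing.exists_irreducible (integralClosure R0 L)
    have hπ0 : (π : L) ≠ 0 := fun h => hπ.ne_zero (Subtype.ext h)
    have hcone : ∀ ϖ : integralClosure R0 L, Irreducible ϖ → ∃ P : Set L, IsCone P ∧ (ϖ : L) ∈ P := by
      intro ϖ hϖ
      obtain ⟨S, hS, -, hS'⟩ := cone_lift (e.toRingHom.comp φ) ϖ hϖ.ne_zero (by
        intro r
        change e (φ r) = 0 ↔ _
        rw [map_eq_zero_iff e e.injective, IsLocalRing.residue_eq_zero_iff,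
          hϖ.maximalIdeal_eq, Ideal.mem_span_singleton]) (by
        intro r hr
        exact FiniteMultiplicity.of_not_isUnit hϖ.not_isUnit hr) cone_real
      obtain ⟨P, hP, hP'⟩ := cone_frac (K := L) hS
      exact ⟨P, hP, (hP' ϖ).2 hS'⟩
    refine ⟨π, hπ0, ?_, hunit, hcone π hπ, ?_⟩
    · -- decomposition
      have hIntg : ∀ a : integralClosure R0 L, a ≠ 0 → ∃ s : L, s ≠ 0 ∧
          ((a : L) = s * s ∨ (a : L) = -(s * s) ∨ (a : L) = π * (s * s) ∨
            (a : L) = -(π * (s * s))) := by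
        intro a ha
        obtain ⟨m, v, hv⟩ := IsDiscreteValuationRing.eq_unit_mul_pow_irreducible ha hπ
        have hvi : ((v⁻¹ : (integralClosure R0 L)ˣ) : integralClosure R0 L) = ((v : integralClosure R0 L) : L)⁻¹ := by
          symm
          apply inv_eq_of_mul_eq_one_right
          exact_mod_cast congrArg Subtype.val v.mul_inv
        obtain ⟨s, hs⟩ := hunit ((v : integralClosure R0 L) : L) (v : integralClosure R0 L).2 (by
          rw [← hvi]
          exact ((v⁻¹ : (integralClosure R0 L)ˣ) : integralClosure R0 L).2)
        have hav : (a : L) = ((v : integralClosure R0 L) : L) * (π : L) ^ m := by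
          rw [hv]; push_cast; rfl
        have hs0 : s ≠ 0 := by
          rintro rfl
          have : ((v : integralClosure R0 L) : L) = 0 := by rcases hs with h | h <;> simpa using h
          exact v.ne_zero (Subtype.ext this)
        refine ⟨s * (π : L) ^ (m / 2), mul_ne_zero hs0 (pow_ne_zero _ hπ0), ?_⟩
        rcases Nat.even_or_odd' m with ⟨j, rfl | rfl⟩
        · have hj : 2 * j / 2 = j := by omega
          rw [hj, hav]
          rcases hs with h | h
          · left; rw [h]; ring
          · right; left; rw [h]; ring
        · have hj : (2 * j + 1) / 2 = j := by omega
          rw [hj, hav]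
          rcases hs with h | h
          · right; right; left; rw [h]; ring
          · right; right; right; rw [h]; ring
      intro a ha
      rcases int_or_inv a with h | h
      · exact hIntg ⟨a, h⟩ (fun h => ha (congrArg Subtype.val h))
      · obtain ⟨s, hs0, hs⟩ := hIntg ⟨a⁻¹, h⟩ (fun h => inv_ne_zero ha (congrArg Subtype.val h))
        refine ⟨a * s, mul_ne_zero ha hs0, ?_⟩
        have haa : a * a * a⁻¹ = a := by field_simp
        simp only at hs
        rcases hs with h | h | h | h
        · left; linear_combination a * a * h - haa
        · right; left; linear_combination a * a * h - haa
        · right; right; left; linear_combination a * a * h - haa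
        · right; right; right; linear_combination a * a * h - haa
    · have := hcone (-π) ((Associated.neg_left (Associated.refl π)).symm.irreducible hπ)
      simpa using this

/-- If no ordering of `L` makes `x` and `g` positive, then one of `-1,-x,-g,-xg` is a square. -/
lemma no_cone_two (x g : L) (hx : x ≠ 0) (hg : g ≠ 0)
    (h : ∀ P : Set L, IsCone P → x ∈ P → g ∈ P → False) :
    ∃ s : L, -1 = s * s ∨ -x = s * s ∨ -g = s * s ∨ -(x * g) = s * s := by
  rcases L_dich L with ⟨s, hs⟩ | ⟨u, hu, hdec, -, ⟨P, hP, hPu⟩, ⟨Q, hQ, hQu⟩⟩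
  · exact ⟨s, Or.inl hs⟩
  have hQu' : ∀ s, -(u * (s * s)) ∈ Q := by
    intro s
    rw [← neg_mul]
    exact hQ.mul _ hQu _ (hQ.mul_self s)
  have hPu' : ∀ s, u * (s * s) ∈ P := fun s => hP.mul _ hPu _ (hP.mul_self s)
  obtain ⟨s, hs0, hs⟩ := hdec x hx
  obtain ⟨t, ht0, ht⟩ := hdec g hg
  rcases hs with hs | hs | hs | hs
  · rcases ht with ht | ht | ht | ht
    · exact (h P hP (hs ▸ hP.mul_self s) (ht ▸ hP.mul_self t)).elim
    · exact ⟨t, by simp [ht]⟩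
    · exact (h P hP (hs ▸ hP.mul_self s) (ht ▸ hPu' t)).elim
    · exact (h Q hQ (hs ▸ hQ.mul_self s) (ht ▸ hQu' t)).elim
  · exact ⟨s, by simp [hs]⟩
  · rcases ht with ht | ht | ht | ht
    · exact (h P hP (hs ▸ hPu' s) (ht ▸ hP.mul_self t)).elim
    · exact ⟨t, by simp [ht]⟩
    · exact (h P hP (hs ▸ hPu' s) (ht ▸ hPu' t)).elim
    · refine ⟨u * s * t, ?_⟩
      right; right; right
      rw [hs, ht]; ring
  · rcases ht with ht | ht | ht | ht
    · exact (h Q hQ (hs ▸ hQu' s) (ht ▸ hQ.mul_self t)).elim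
    · exact ⟨t, by simp [ht]⟩
    · refine ⟨u * s * t, ?_⟩
      right; right; right
      rw [hs, ht]; ring
    · exact (h Q hQ (hs ▸ hQu' s) (ht ▸ hQu' t)).elim

end FiniteExt


/-! ### Norm forms -/

lemma poly_aniso (g : Polynomial ℝ) (hg : Set.Infinite {r : ℝ | 0 < g.eval r})
    (a b : Polynomial ℝ) (h : a * a + g * (b * b) = 0) : a = 0 ∧ b = 0 := by
  have key : ∀ r ∈ {r : ℝ | 0 < g.eval r}, a.eval r = 0 ∧ b.eval r = 0 := by
    intro r hr
    change 0 < g.eval r at hr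
    have h1 := congrArg (Polynomial.eval r) h
    simp only [Polynomial.eval_add, Polynomial.eval_mul, Polynomial.eval_zero] at h1
    have h2 := mul_self_nonneg (a.eval r)
    have h3 := mul_nonneg hr.le (mul_self_nonneg (b.eval r))
    have h4 : a.eval r * a.eval r = 0 := by linarith
    have h5 : g.eval r * (b.eval r * b.eval r) = 0 := by linarith
    refine ⟨mul_self_eq_zero.1 h4, ?_⟩
    rcases mul_eq_zero.1 h5 with h6 | h6
    · exact absurd h6 hr.ne'
    · exact mul_self_eq_zero.1 h6
  constructor
  · exact Polynomial.eq_zero_of_infinite_isRoot _ (hg.mono fun r hr => (key r hr).1)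
  · exact Polynomial.eq_zero_of_infinite_isRoot _ (hg.mono fun r hr => (key r hr).2)

lemma poly_X_dvd (a : Polynomial R0) (h : a.map PowerSeries.constantCoeff = 0) :
    ∃ a', a = Polynomial.C PowerSeries.X * a' := by
  change Polynomial.C PowerSeries.X ∣ a
  rw [Polynomial.C_dvd_iff_dvd_coeff]
  intro i
  have := congrArg (fun q => Polynomial.coeff q i) h
  simp only [Polynomial.coeff_map, Polynomial.coeff_zero] at this
  exact PowerSeries.X_dvd_iff.2 this

lemma coe_C_eq (r : R0) : ((Polynomial.C r : Polynomial R0) : BB) = PowerSeries.C r :=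
  Polynomial.coe_C r

/-- elements of `BB` that are, up to sign, in the preordering -/
def GG (n : ℕ) (a : BB) : Prop := a ∈ TT n ∨ -a ∈ TT n

lemma GG.mul {n : ℕ} {a b : BB} (ha : GG n a) (hb : GG n b) : GG n (a * b) := by
  rcases ha with ha | ha <;> rcases hb with hb | hb
  · exact Or.inl (mul_mem ha hb)
  · right; have := mul_mem ha hb; rwa [mul_neg] at this
  · right; have := mul_mem ha hb; rwa [neg_mul] at this
  · left; have := mul_mem ha hb; rwa [neg_mul_neg] at this

lemma GG_unit (n : ℕ) (u : BB) (hu : IsUnit u) : GG n u := by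
  obtain ⟨g, -, h | h⟩ := BB_unit u hu
  · left; rw [h]; exact TT_sq n g
  · right; rw [h, neg_neg]; exact TT_sq n g

lemma norm_descent (n : ℕ) (p g : Polynomial R0) (hgT : (g : BB) ∈ TT n)
    (hg : Set.Infinite {r : ℝ | 0 < (g.map PowerSeries.constantCoeff).eval r})
    (v : R0) (hv : IsUnit v) (m : ℕ) :
    ∀ (i j : ℕ), i ≤ 1 → j ≤ 1 → ∀ a b : Polynomial R0,
      Polynomial.C (PowerSeries.X ^ i) * (a * a) + Polynomial.C (PowerSeries.X ^ j) * (g * (b * b))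
        = Polynomial.C (PowerSeries.X ^ m * v) * p → GG n (p : BB) := by
  have hgne : g.map PowerSeries.constantCoeff ≠ 0 := by
    intro h
    rw [h] at hg
    simp at hg
  have hX0 : (Polynomial.C PowerSeries.X : Polynomial R0) ≠ 0 :=
    Polynomial.C_ne_zero.2 PowerSeries.X_ne_zero
  induction m with
  | zero =>
    intro i j _ _ a b h
    obtain ⟨w, hw⟩ := hv.exists_left_inv
    have h1 : (p : BB) = PowerSeries.C w * (bx ^ i * ((a : BB) * a) + bx ^ j * ((g : BB) * ((b : BB) * b))) := by
      have h2 := congrArg (fun q : Polynomial R0 => (q : BB)) h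
      simp only [Polynomial.coe_add, Polynomial.coe_mul, coe_C_eq] at h2
      rw [map_pow, map_pow, map_mul, map_pow] at h2
      rw [h2, pow_zero, one_mul, ← mul_assoc, ← map_mul, hw, map_one, one_mul]
    rw [h1]
    apply GG.mul
    · apply GG_unit
      exact (IsUnit.of_mul_eq_one _ hw).map PowerSeries.C
    · left
      exact add_mem (mul_mem (pow_mem (TT_x n) _) (TT_sq n _))
        (mul_mem (pow_mem (TT_x n) _) (mul_mem hgT (TT_sq n _)))
  | succ m ih =>
    intro i j hi hj a b h
    have hmod := congrArg (Polynomial.map PowerSeries.constantCoeff) h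
    simp only [Polynomial.map_add, Polynomial.map_mul, Polynomial.map_C, map_mul, map_pow,
      PowerSeries.constantCoeff_X] at hmod
    have hi' : i = 0 ∨ i = 1 := by omega
    have hj' : j = 0 ∨ j = 1 := by omega
    rcases hi' with rfl | rfl <;> rcases hj' with rfl | rfl
    · simp at hmod
      obtain ⟨ha, hb⟩ := poly_aniso _ hg _ _ hmod
      obtain ⟨a', rfl⟩ := poly_X_dvd a ha
      obtain ⟨b', rfl⟩ := poly_X_dvd b hb
      apply ih 1 1 le_rfl le_rfl a' b'
      apply mul_left_cancel₀ hX0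
      simp only [map_mul, map_pow, pow_zero, pow_one, pow_succ, map_one] at h ⊢
      linear_combination h
    · simp at hmod
      obtain ⟨a', rfl⟩ := poly_X_dvd a hmod
      apply ih 1 0 le_rfl zero_le_one a' b
      apply mul_left_cancel₀ hX0
      simp only [map_mul, map_pow, pow_zero, pow_one, pow_succ, map_one] at h ⊢
      linear_combination h
    · simp [hgne] at hmod
      obtain ⟨b', rfl⟩ := poly_X_dvd b hmod
      apply ih 0 1 zero_le_one le_rfl a b'
      apply mul_left_cancel₀ hX0
      simp only [map_mul, map_pow, pow_zero, pow_one, pow_succ, map_one] at h ⊢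
      linear_combination h
    · apply ih 0 0 zero_le_one zero_le_one a b
      apply mul_left_cancel₀ hX0
      simp only [map_mul, map_pow, pow_zero, pow_one, pow_succ, map_one] at h ⊢
      linear_combination h

/-- Thue-type lemma -/
lemma thue {K : Type*} [Field K] (q h g : Polynomial K) (hq : q.Monic) (hq1 : 0 < q.natDegree) (hg : g.natDegree ≤ 1)
    (hd : q ∣ h * h + g) : ∃ (a b : Polynomial K) (c : K), (a ≠ 0 ∨ b ≠ 0) ∧
      a * a + g * (b * b) = Polynomial.C c * q := by
  obtain ⟨δ, hδ1, hgδ, hδ⟩ : ∃ δ, δ ≤ 1 ∧ g.natDegree = δ ∧ True := ⟨g.natDegree, hg, rfl, trivial⟩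
  set e := q.natDegree
  let V := Polynomial.degreeLT K (e / 2 + 1)
  let W := Polynomial.degreeLT K ((e - δ) / 2 + 1)
  have hV : Module.finrank K V = e / 2 + 1 := by
    rw [(Polynomial.degreeLTEquiv K _).finrank_eq]; simp
  have hW : Module.finrank K W = (e - δ) / 2 + 1 := by
    rw [(Polynomial.degreeLTEquiv K _).finrank_eq]; simp
  have fV : FiniteDimensional K V := (Polynomial.degreeLTEquiv K _).symm.finiteDimensional
  have fW : FiniteDimensional K W := (Polynomial.degreeLTEquiv K _).symm.finiteDimensional
  let f : (V × W) →ₗ[K] (Polynomial K ⧸ Ideal.span {q}) :=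
    (Ideal.Quotient.mkₐ K (Ideal.span {q})).toLinearMap ∘ₗ
      (V.subtype ∘ₗ LinearMap.fst K V W - (LinearMap.mulLeft K h) ∘ₗ W.subtype ∘ₗ LinearMap.snd K V W)
  have hfin : Module.finrank K (Polynomial K ⧸ Ideal.span {q}) = e :=
    finrank_quotient_span_eq_natDegree
  have fq : FiniteDimensional K (Polynomial K ⧸ Ideal.span {q}) := by
    apply FiniteDimensional.of_finrank_pos
    rw [hfin]; exact hq1
  have hker : LinearMap.ker f ≠ ⊥ := by
    apply LinearMap.ker_ne_bot_of_finrank_lt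
    rw [hfin, Module.finrank_prod, hV, hW]
    omega
  obtain ⟨⟨a, b⟩, hab, hne⟩ := Submodule.exists_mem_ne_zero_of_ne_bot hker
  have hdv : q ∣ (a : Polynomial K) - h * b := by
    rw [← Ideal.mem_span_singleton, ← Ideal.Quotient.eq_zero_iff_mem]
    exact hab
  have hdv2 : q ∣ (a : Polynomial K) * a + g * (b * b) := by
    have h1 : (a : Polynomial K) * a + g * (b * b) = (a - h * b) * (a + h * b) + (h * h + g) * (b * b) := by
      ring
    rw [h1]
    exact dvd_add (dvd_mul_of_dvd_left hdv _) (dvd_mul_of_dvd_left hd _)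
  have hda : (a : Polynomial K).natDegree ≤ e / 2 := by
    have := Polynomial.mem_degreeLT.1 a.2
    by_cases h0 : (a : Polynomial K) = 0
    · simp [h0]
    · have := (Polynomial.natDegree_lt_iff_degree_lt h0).2 this
      omega
  have hdb : (b : Polynomial K).natDegree ≤ (e - δ) / 2 := by
    have := Polynomial.mem_degreeLT.1 b.2
    by_cases h0 : (b : Polynomial K) = 0
    · simp [h0]
    · have := (Polynomial.natDegree_lt_iff_degree_lt h0).2 this
      omega
  have hdeg : ((a : Polynomial K) * a + g * (b * b)).natDegree ≤ e := by
    refine Polynomial.natDegree_add_le_of_degree_le ?_ ?_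
    · refine (Polynomial.natDegree_mul_le).trans ?_
      omega
    · refine (Polynomial.natDegree_mul_le).trans ?_
      have := Polynomial.natDegree_mul_le (p := (b : Polynomial K)) (q := b)
      omega
  obtain ⟨c, hc⟩ := hdv2
  refine ⟨a, b, c.coeff 0, ?_, ?_⟩
  · by_contra! hcon
    apply hne
    exact Prod.ext (Subtype.ext hcon.1) (Subtype.ext hcon.2)
  · rw [hc] at hdeg ⊢
    have : c.natDegree = 0 := by
      by_cases hc0 : c = 0
      · simp [hc0]
      · rw [hq.natDegree_mul' hc0] at hdeg
        change e + _ ≤ e at hdeg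
        omega
    rw [Polynomial.natDegree_eq_zero] at this
    obtain ⟨d, rfl⟩ := this
    simp [mul_comm]

/-- a cone on `BB` with `x,y,x^n-y` positive -/
lemma exists_S0 (n : ℕ) : ∃ S : Set BB, IsCone S ∧ bx ∈ S ∧ bY ∈ S ∧ bx ^ n - bY ∈ S := by
  have injK : Function.Injective (algebraMap R0 KK) := IsFractionRing.injective R0 KK
  obtain ⟨S1, hS1, -, hX⟩ := cone_lift (PowerSeries.constantCoeff (R := ℝ)) PowerSeries.X
    PowerSeries.X_ne_zero (fun r => PowerSeries.X_dvd_iff.symm)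
    (fun r hr => FiniteMultiplicity.of_not_isUnit PowerSeries.X_prime.not_isUnit hr) cone_real
  obtain ⟨P, hP, hP'⟩ := cone_frac (K := KK) hS1
  have hX' : algebraMap R0 KK PowerSeries.X ∈ P := (hP' _).2 hX
  have hX0 : algebraMap R0 KK PowerSeries.X ≠ 0 := by
    intro h
    exact PowerSeries.X_ne_zero (injK (by rw [h, map_zero]))
  let φ : BB →+* KK := (algebraMap R0 KK).comp PowerSeries.constantCoeff
  have hφ : ∀ r : BB, φ r = algebraMap R0 KK (PowerSeries.constantCoeff r) := fun r => rfl
  obtain ⟨S, hS, h1, h2⟩ := cone_lift φ bY PowerSeries.X_ne_zero (fun r => by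
      rw [hφ, map_eq_zero_iff _ injK]
      exact PowerSeries.X_dvd_iff.symm)
    (fun r hr => by
      refine ⟨(PowerSeries.order r).toNat, fun h => ?_⟩
      have h3 := PowerSeries.nat_le_order r _ (PowerSeries.X_pow_dvd_iff.1 h)
      have h4 := ENat.coe_toNat ((PowerSeries.order_finite_iff_ne_zero.2 hr).ne)
      have h5 := Nat.cast_le.1 (h3.trans h4.symm.le)
      omega) hP
  have hx : φ bx = algebraMap R0 KK PowerSeries.X := by simp [hφ]
  have hy : φ bY = 0 := by simp [hφ]
  have hz : φ (bx ^ n - bY) = (algebraMap R0 KK PowerSeries.X) ^ n := by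
    rw [map_sub, map_pow, hx, hy, sub_zero]
  refine ⟨S, hS, h1 _ ?_ ?_, h2, h1 _ ?_ ?_⟩
  · rw [hx]; exact hX'
  · rw [hx]; exact hX0
  · rw [hz]; exact hP.pow hX' n
  · rw [hz]; exact pow_ne_zero n hX0

lemma TT_le_cone {n : ℕ} {S : Set BB} (hS : IsCone S) (hx : bx ∈ S) (hy : bY ∈ S)
    (hz : bx ^ n - bY ∈ S) {a : BB} (ha : a ∈ TT n) : a ∈ S := by
  apply hS.semiring_le (G := {bx, bY, bx ^ n - bY}) _ ha
  rintro b (rfl | rfl | rfl)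
  · exact hx
  · exact hy
  · exact hz

lemma BB_aniso (n : ℕ) (g a b : BB) (hg : g ∈ TT n) (hg0 : g ≠ 0)
    (h : a * a + g * (b * b) = 0) : a = 0 ∧ b = 0 := by
  obtain ⟨S, hS, hx, hy, hz⟩ := exists_S0 n
  have h1 : g * (b * b) ∈ S := hS.mul _ (TT_le_cone hS hx hy hz hg) _ (hS.mul_self b)
  have h2 : a * a = 0 := by
    apply hS.anti _ (hS.mul_self a)
    have : -(a * a) = g * (b * b) := by linear_combination -h
    rw [this]; exact h1
  have ha := mul_self_eq_zero.1 h2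
  refine ⟨ha, ?_⟩
  rw [h2, zero_add] at h
  exact mul_self_eq_zero.1 ((mul_eq_zero.1 h).resolve_left hg0)

/-- the norm form lemma -/
lemma norm_form (n : ℕ) (p g : Polynomial R0) (hp : p.Monic) (hp1 : 0 < p.natDegree)
    (hgT : (g : BB) ∈ TT n) (hgd : g.natDegree ≤ 1)
    (hg : Set.Infinite {r : ℝ | 0 < (g.map PowerSeries.constantCoeff).eval r})
    (δ : ℕ) (hδ : δ ≤ 1) (h : Polynomial KK)
    (hd : p.map (algebraMap R0 KK) ∣ h * h + (Polynomial.C (PowerSeries.X ^ δ) * g).map (algebraMap R0 KK)) :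
    GG n (p : BB) := by
  have injK : Function.Injective (algebraMap R0 KK) := IsFractionRing.injective R0 KK
  set g' := Polynomial.C (PowerSeries.X ^ δ) * g with hg'
  have hg'd : g'.natDegree ≤ 1 := (Polynomial.natDegree_C_mul_le _ _).trans hgd
  have hgne : g ≠ 0 := by
    rintro rfl
    simp at hg
  have hg'T : (g' : BB) ∈ TT n := by
    rw [hg', Polynomial.coe_mul, coe_C_eq, map_pow]
    exact mul_mem (pow_mem (TT_x n) _) hgT
  have hg'0 : (g' : BB) ≠ 0 := by
    rw [Ne, Polynomial.coe_eq_zero_iff]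
    exact mul_ne_zero (Polynomial.C_ne_zero.2 (pow_ne_zero _ PowerSeries.X_ne_zero)) hgne
  obtain ⟨a, b, c, hab, habc⟩ := thue (p.map (algebraMap R0 KK)) h (g'.map (algebraMap R0 KK))
    (hp.map _) (by rwa [Polynomial.natDegree_map_eq_of_injective injK])
    (by rwa [Polynomial.natDegree_map_eq_of_injective injK]) hd
  obtain ⟨d1, hd1, hA⟩ := IsLocalization.integerNormalization_spec (nonZeroDivisors R0) a
  obtain ⟨d2, hd2, hB⟩ := IsLocalization.integerNormalization_spec (nonZeroDivisors R0) b
  set A := IsLocalization.integerNormalization (nonZeroDivisors R0) a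
  set B := IsLocalization.integerNormalization (nonZeroDivisors R0) b
  rw [← IsScalarTower.algebraMap_smul KK, Polynomial.smul_eq_C_mul] at hA hB
  have hd1' := nonZeroDivisors.ne_zero hd1
  have hd2' := nonZeroDivisors.ne_zero hd2
  have e1 : algebraMap R0 KK d1 ≠ 0 := fun h => hd1' (injK (by rw [h, map_zero]))
  have e2 : algebraMap R0 KK d2 ≠ 0 := fun h => hd2' (injK (by rw [h, map_zero]))
  let A' := Polynomial.C d2 * A
  let B' := Polynomial.C d1 * B
  have hF : (A' * A' + g' * (B' * B')).map (algebraMap R0 KK) =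
      Polynomial.C (algebraMap R0 KK d1 * algebraMap R0 KK d2 * (algebraMap R0 KK d1 * algebraMap R0 KK d2) * c)
        * p.map (algebraMap R0 KK) := by
    simp only [A', B', Polynomial.map_add, Polynomial.map_mul, Polynomial.map_C, hA, hB]
    simp only [map_mul]
    rw [mul_assoc _ (Polynomial.C c), ← habc]
    ring
  set γ := (A' * A' + g' * (B' * B')).coeff p.natDegree with hγ
  have hF2 : A' * A' + g' * (B' * B') = Polynomial.C γ * p := by
    apply Polynomial.map_injective _ injK
    rw [hF, Polynomial.map_mul, Polynomial.map_C]
    congr 2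
    rw [hγ, ← Polynomial.coeff_map, hF, Polynomial.coeff_C_mul, Polynomial.coeff_map,
      Polynomial.coeff_natDegree, hp.leadingCoeff, map_one, mul_one]
  have hAB : A' ≠ 0 ∨ B' ≠ 0 := by
    rcases hab with h | h
    · left
      refine mul_ne_zero (Polynomial.C_ne_zero.2 hd2') fun h0 => ?_
      rw [h0, Polynomial.map_zero] at hA
      exact mul_ne_zero (Polynomial.C_ne_zero.2 e1) h hA.symm
    · right
      refine mul_ne_zero (Polynomial.C_ne_zero.2 hd1') fun h0 => ?_
      rw [h0, Polynomial.map_zero] at hB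
      exact mul_ne_zero (Polynomial.C_ne_zero.2 e2) h hB.symm
  have hγ0 : γ ≠ 0 := by
    intro h0
    rw [h0, map_zero, zero_mul] at hF2
    have h1 := congrArg (fun q : Polynomial R0 => (q : BB)) hF2
    simp only [Polynomial.coe_add, Polynomial.coe_mul, Polynomial.coe_zero] at h1
    obtain ⟨h2, h3⟩ := BB_aniso n _ _ _ hg'T hg'0 h1
    rw [Polynomial.coe_eq_zero_iff] at h2 h3
    rcases hAB with h | h
    · exact h h2
    · exact h h3
  obtain ⟨m, v, hv, hmv⟩ := R0_factor γ hγ0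
  apply norm_descent n p g hgT hg v hv m 0 δ zero_le_one hδ A' B'
  rw [← hmv, ← hF2, hg']
  simp only [pow_zero, map_one, one_mul]
  ring


/-! ### The strictly positive case -/

lemma TT_const (n : ℕ) (c : ℝ) (hc : 0 < c) : (PowerSeries.C (PowerSeries.C c) : BB) ∈ TT n := by
  obtain ⟨s, -, hs⟩ := real_sqrt_unit c hc
  rw [hs, map_mul, map_mul]
  exact TT_sq n _

lemma TT_pow_sub (n b : ℕ) : bx ^ (n * b) - bY ^ b ∈ TT n := by
  induction b with
  | zero => simp
  | succ b ih =>
    have : bx ^ (n * (b + 1)) - bY ^ (b + 1) =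
        bx ^ n * (bx ^ (n * b) - bY ^ b) + bY ^ b * (bx ^ n - bY) := by ring
    rw [this]
    exact add_mem (mul_mem (pow_mem (TT_x n) _) ih) (mul_mem (pow_mem (TT_y n) _) (TT_z n))

lemma TT_term (n N b : ℕ) (a : R0) (h : PowerSeries.X ^ (N + 1) ∣ a * PowerSeries.X ^ (n * b))
    (c : ℝ) (hc : 0 < c) :
    PowerSeries.C a * bY ^ b + PowerSeries.C (PowerSeries.C c) * bx ^ N ∈ TT n := by
  have hcx : PowerSeries.C (PowerSeries.C c) * bx ^ N ∈ TT n :=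
    mul_mem (TT_const n c hc) (pow_mem (TT_x n) _)
  by_cases ha : a = 0
  · rw [ha, map_zero, zero_mul, zero_add]; exact hcx
  obtain ⟨k, v, hv, rfl⟩ := R0_factor a ha
  have hk : N + 1 ≤ k + n * b := by
    have h1 : PowerSeries.X ^ (k) * v * PowerSeries.X ^ (n * b) =
        v * (PowerSeries.X ^ (k + n * b) : R0) := by ring
    rw [h1, hv.dvd_mul_left] at h
    exact (pow_dvd_pow_iff PowerSeries.X_ne_zero PowerSeries.X_prime.not_isUnit).1 h
  obtain ⟨s, -, rfl | rfl⟩ := R0_unit v hv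
  · refine add_mem (mul_mem ?_ (pow_mem (TT_y n) _)) hcx
    rw [map_mul, map_pow, map_mul]
    exact mul_mem (pow_mem (TT_x n) _) (TT_sq n _)
  · obtain ⟨l, hl⟩ := Nat.exists_eq_add_of_le hk
    obtain ⟨g, -, hg⟩ := R0_sqrt (PowerSeries.C c - PowerSeries.X ^ (l + 1) * (s * s))
      (by simpa using hc)
    have h1 : PowerSeries.C (PowerSeries.X ^ k * -(s * s)) * bY ^ b +
        PowerSeries.C (PowerSeries.C c) * bx ^ N =
        bx ^ k * (PowerSeries.C s * PowerSeries.C s) * (bx ^ (n * b) - bY ^ b) +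
          bx ^ N * (PowerSeries.C g * PowerSeries.C g) := by
      rw [← map_mul PowerSeries.C g g, ← hg]
      simp only [map_mul, map_pow, map_neg, map_sub]
      have h2 : bx ^ k * bx ^ (n * b) = bx ^ N * bx ^ (l + 1) := by
        rw [← pow_add, ← pow_add, hl]; congr 1; ring
      linear_combination (-(PowerSeries.C s * PowerSeries.C s)) * h2
    rw [h1]
    exact add_mem (mul_mem (mul_mem (pow_mem (TT_x n) _) (TT_sq n _)) (TT_pow_sub n b))
      (mul_mem (pow_mem (TT_x n) _) (TT_sq n _))

lemma TT_strict (n N : ℕ) (q : Polynomial R0) (s : R0) (hs : IsUnit s)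
    (h0 : q.coeff 0 = PowerSeries.X ^ N * (s * s))
    (hb : ∀ b, 1 ≤ b → PowerSeries.X ^ (N + 1) ∣ q.coeff b * PowerSeries.X ^ (n * b)) :
    (q : BB) ∈ TT n := by
  set e := q.natDegree
  have hs0 : PowerSeries.constantCoeff s ≠ 0 := (hs.map PowerSeries.constantCoeff).ne_zero
  set c0 := PowerSeries.constantCoeff s * PowerSeries.constantCoeff s
  have hc0 : 0 < c0 := mul_self_pos.2 hs0
  have hc : 0 < c0 / (e + 1) := by positivity
  obtain ⟨g, -, hg⟩ := R0_sqrt (s * s - e * PowerSeries.C (c0 / (e + 1))) (by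
    simp only [map_sub, map_mul, map_natCast, PowerSeries.constantCoeff_C]
    change 0 < c0 - _
    have : c0 - e * (c0 / (e + 1)) = c0 / (e + 1) := by field_simp; ring
    rw [this]; exact hc)
  have hq : (q : BB) = bx ^ N * (PowerSeries.C g * PowerSeries.C g) +
      ∑ b ∈ Finset.range e, (PowerSeries.C (q.coeff (b + 1)) * bY ^ (b + 1) +
        PowerSeries.C (PowerSeries.C (c0 / (e + 1))) * bx ^ N) := by
    have h1 : (q : BB) = ∑ b ∈ Finset.range (e + 1), PowerSeries.C (q.coeff b) * bY ^ b := by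
      conv_lhs => rw [q.as_sum_range_C_mul_X_pow]
      rw [← Polynomial.coeToPowerSeries.ringHom_apply, map_sum]
      apply Finset.sum_congr rfl
      intro b _
      simp
    rw [h1, Finset.sum_range_succ', Finset.sum_add_distrib, h0, ← map_mul PowerSeries.C g g, ← hg]
    simp only [map_mul, map_pow, map_sub, map_natCast, pow_zero, Finset.sum_const,
      Finset.card_range, nsmul_eq_mul]
    ring
  rw [hq]
  refine add_mem (mul_mem (pow_mem (TT_x n) _) (TT_sq n _)) (sum_mem fun b _ => ?_)
  exact TT_term n N (b + 1) _ (hb _ (by omega)) _ hc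

lemma GG_strict (n N : ℕ) (p : Polynomial R0) (v : R0) (hv : IsUnit v)
    (h0 : p.coeff 0 = PowerSeries.X ^ N * v)
    (hb : ∀ b, 1 ≤ b → PowerSeries.X ^ (N + 1) ∣ p.coeff b * PowerSeries.X ^ (n * b)) :
    GG n (p : BB) := by
  obtain ⟨s, hs, rfl | rfl⟩ := R0_unit v hv
  · exact Or.inl (TT_strict n N p s hs h0 hb)
  · right
    rw [← Polynomial.coe_neg]
    refine TT_strict n N (-p) s hs (by rw [Polynomial.coeff_neg, h0]; ring) fun b h => ?_
    rw [Polynomial.coeff_neg, neg_mul, dvd_neg]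
    exact hb b h

section FiniteExt

variable {L : Type*} [Field L] [Algebra R0 L] [Algebra KK L] [IsScalarTower R0 KK L]
  [FiniteDimensional KK L]

lemma small_inv_case (n : ℕ) (p : Polynomial R0) (hp : p.Monic)
    (y : L) (hy0 : y ≠ 0)
    (hmin : ∀ q : Polynomial R0, Polynomial.aeval y q = 0 → p ∣ q)
    (hfr : Module.finrank KK L ≤ p.natDegree)
    (ht : IsSmall (algebraMap R0 L PowerSeries.X ^ n / y)) : GG n (p : BB) := by
  set t := algebraMap R0 L PowerSeries.X ^ n / y with htdef
  set q := minpoly R0 t with hqdef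
  have hq := small_minpoly t ht
  rw [← hqdef] at hq
  set d := q.natDegree with hd
  have hde : d ≤ p.natDegree := by
    refine le_trans ?_ hfr
    have h1 := minpoly.natDegree_le (A := KK) t
    rw [minpoly.isIntegrallyClosed_eq_field_fractions' KK ht.1,
      (minpoly.monic ht.1).natDegree_map] at h1
    exact h1
  let Q : Polynomial R0 := ∑ b ∈ Finset.range (d + 1),
    Polynomial.C (q.coeff (d - b) * PowerSeries.X ^ (n * (d - b))) * Polynomial.X ^ b
  have hQc : ∀ b, Q.coeff b = if b < d + 1 then q.coeff (d - b) * PowerSeries.X ^ (n * (d - b)) else 0 := by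
    intro b
    simp only [Q, Polynomial.finsetSum_coeff, Polynomial.coeff_C_mul_X_pow]
    rw [Finset.sum_ite_eq]
    simp
  have hQ0 : Polynomial.aeval y Q = 0 := by
    have h1 : Polynomial.aeval t q = 0 := minpoly.aeval R0 t
    rw [Polynomial.aeval_eq_sum_range, ← Finset.sum_flip] at h1
    have h2 : Polynomial.aeval y Q = y ^ d * ∑ r ∈ Finset.range (q.natDegree + 1),
        q.coeff (q.natDegree - r) • t ^ (q.natDegree - r) := by
      simp only [Q, map_sum, Finset.mul_sum]
      apply Finset.sum_congr rfl
      intro b hb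
      have hb' : b ≤ d := by simpa [Nat.lt_succ_iff] using hb
      rw [← hd, htdef, Algebra.smul_def, div_pow]
      have h3 : y ^ d = y ^ b * y ^ (d - b) := by rw [← pow_add]; congr 1; omega
      rw [h3]
      simp only [map_mul, map_pow, Polynomial.aeval_C, Polynomial.aeval_X]
      have := pow_ne_zero (d - b) hy0
      field_simp
      try ring
    rw [h2, h1, mul_zero]
  have hQd : Q.coeff 0 = PowerSeries.X ^ (n * d) := by
    rw [hQc, if_pos (by omega), Nat.sub_zero, Polynomial.coeff_natDegree, hq.monic.leadingCoeff,
      one_mul]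
  have hQne : Q ≠ 0 := by
    intro h
    rw [h, Polynomial.coeff_zero] at hQd
    exact pow_ne_zero _ PowerSeries.X_ne_zero hQd.symm
  have hQdeg : Q.natDegree ≤ d := by
    rw [Polynomial.natDegree_le_iff_coeff_eq_zero]
    intro b hb
    rw [hQc, if_neg (by omega)]
  obtain ⟨c', hc'⟩ := hmin Q hQ0
  have hc'0 : c' ≠ 0 := by
    rintro rfl
    exact hQne (by rw [hc', mul_zero])
  have hc'd : c'.natDegree = 0 := by
    have : Q.natDegree = p.natDegree + c'.natDegree := by rw [hc', hp.natDegree_mul' hc'0]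
    omega
  obtain ⟨c, rfl⟩ := Polynomial.natDegree_eq_zero.1 hc'd
  have hc0 : c ≠ 0 := by
    rintro rfl
    exact hc'0 (map_zero _)
  have hcb : ∀ b, p.coeff b * c = Q.coeff b := by
    intro b
    rw [hc', Polynomial.coeff_mul_C]
  have hp0 : p.coeff 0 ≠ 0 := by
    intro h
    have := hcb 0
    rw [h, zero_mul, hQd] at this
    exact pow_ne_zero _ PowerSeries.X_ne_zero this.symm
  obtain ⟨N, v, hv, hN⟩ := R0_factor _ hp0
  refine GG_strict n N p v hv hN fun b hb => ?_
  by_cases hbd : b < d + 1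
  · have hmem := hq.mem (n := d - b) (by omega)
    rw [R0_mem_max] at hmem
    obtain ⟨r, hr⟩ := hmem
    have h1 := hcb b
    rw [hQc, if_pos hbd, hr] at h1
    have h2 := hcb 0
    rw [hQd, hN] at h2
    refine ⟨v * r, ?_⟩
    apply mul_right_cancel₀ hc0
    have h3 : (PowerSeries.X : R0) ^ (n * (d - b)) * PowerSeries.X ^ (n * b) = PowerSeries.X ^ (n * d) := by
      rw [← pow_add, ← mul_add]; congr 2; omega
    linear_combination (PowerSeries.X ^ (n * b)) * h1 + PowerSeries.X * r * h3 - PowerSeries.X * r * h2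
  · have h1 := hcb b
    rw [hQc, if_neg hbd] at h1
    rw [(mul_eq_zero.1 h1).resolve_right hc0, zero_mul]
    exact dvd_zero _

/-- the main local dichotomy -/
lemma local_dich (n : ℕ) (hn : 0 < n) (p : Polynomial R0) (hp : p.Monic) (hp1 : 0 < p.natDegree)
    (y : L) (hy : Polynomial.aeval y p = 0)
    (hminK : ∀ q : Polynomial KK, Polynomial.aeval y q = 0 → p.map (algebraMap R0 KK) ∣ q)
    (hmin : ∀ q : Polynomial R0, Polynomial.aeval y q = 0 → p ∣ q)
    (hgen : ∀ l : L, ∃ h : Polynomial KK, Polynomial.aeval y h = l)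
    (hfr : Module.finrank KK L ≤ p.natDegree) :
    GG n (p : BB) ∨ (y ≠ 0 ∧ algebraMap R0 L PowerSeries.X ^ n - y ≠ 0 ∧ ∃ P : Set L, IsCone P ∧
      algebraMap R0 L PowerSeries.X ∈ P ∧ y ∈ P ∧ algebraMap R0 L PowerSeries.X ^ n - y ∈ P) := by
  set x := algebraMap R0 L PowerSeries.X with hx
  have hx0 : x ≠ 0 := by
    intro h
    exact PowerSeries.X_ne_zero (R0_L_inj (L := L) (by rw [← hx, h, map_zero]))
  have hdeg1 : ∀ q : Polynomial R0, p ∣ q → q ≠ 0 → q.natDegree ≤ 1 → IsUnit q.leadingCoeff →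
      ∃ c : R0, IsUnit c ∧ q = Polynomial.C c * p := by
    rintro q ⟨c, rfl⟩ h0 hd hu
    have hc0 : c ≠ 0 := right_ne_zero_of_mul h0
    rw [hp.natDegree_mul' hc0] at hd
    obtain ⟨c', rfl⟩ := Polynomial.natDegree_eq_zero.1 (show c.natDegree = 0 by omega)
    refine ⟨c', ?_, mul_comm _ _⟩
    rw [Polynomial.leadingCoeff_mul, hp.leadingCoeff, one_mul, Polynomial.leadingCoeff_C] at hu
    exact hu
  have hdeg1' : ∀ q : Polynomial R0, p ∣ q → q.natDegree = 1 → IsUnit q.leadingCoeff → 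
      (q : BB) ∈ TT n → GG n (p : BB) := by
    intro q h1 h2 h3 h4
    have h0 : q ≠ 0 := by rintro rfl; simp at h2
    obtain ⟨c, hc, hqc⟩ := hdeg1 q h1 h0 h2.le h3
    obtain ⟨w, hw⟩ := hc.exists_left_inv
    have h5 : p = Polynomial.C w * q := by
      rw [hqc, ← mul_assoc, ← map_mul, hw, map_one, one_mul]
    rw [h5, Polynomial.coe_mul, coe_C_eq]
    exact GG.mul (GG_unit n _ ((IsUnit.of_mul_eq_one _ hw).map PowerSeries.C)) (Or.inl h4)
  have hZdeg : (Polynomial.C (PowerSeries.X ^ n) - Polynomial.X : Polynomial R0).natDegree = 1 := by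
    rw [← Polynomial.natDegree_neg, neg_sub, Polynomial.natDegree_X_sub_C]
  have hZT : ((Polynomial.C (PowerSeries.X ^ n) - Polynomial.X : Polynomial R0) : BB) ∈ TT n := by
    rw [Polynomial.coe_sub, coe_C_eq, Polynomial.coe_X, map_pow]
    exact TT_z n
  have hXT : ((Polynomial.X : Polynomial R0) : BB) ∈ TT n := by
    rw [Polynomial.coe_X]; exact TT_y n
  by_cases hy0 : y = 0
  · left
    exact hdeg1' Polynomial.X (hmin _ (by simp [hy0])) Polynomial.natDegree_X (by simp) hXT
  by_cases hz0 : x ^ n - y = 0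
  · left
    refine hdeg1' _ (hmin _ ?_) hZdeg ?_ hZT
    · simpa using hz0
    · rw [← neg_sub Polynomial.X, Polynomial.leadingCoeff_neg, Polynomial.leadingCoeff_X_sub_C]
      exact isUnit_one.neg
  by_cases hno : ∃ P : Set L, IsCone P ∧ x ∈ P ∧ y ∈ P ∧ x ^ n - y ∈ P
  · exact Or.inr ⟨hy0, hz0, hno⟩
  left
  push Not at hno
  have normL : ∀ g : Polynomial R0, (g : BB) ∈ TT n → g.natDegree ≤ 1 →
      Set.Infinite {r : ℝ | 0 < (g.map PowerSeries.constantCoeff).eval r} →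
      ∀ δ : ℕ, δ ≤ 1 → ∀ s : L, -(x ^ δ * Polynomial.aeval y g) = s * s → GG n (p : BB) := by
    intro g h1 h2 h3 δ h4 s hs
    obtain ⟨h, hh⟩ := hgen s
    refine norm_form n p g hp hp1 h1 h2 h3 δ h4 h (hminK _ ?_)
    rw [map_add, map_mul, hh, ← hs, Polynomial.aeval_map_algebraMap, map_mul, Polynomial.aeval_C,
      map_pow, ← hx]
    ring
  have inf1 : Set.Infinite {r : ℝ | 0 < ((1 : Polynomial R0).map PowerSeries.constantCoeff).eval r} := by
    simpa using Set.infinite_univ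
  have infY : Set.Infinite {r : ℝ | 0 < ((Polynomial.X : Polynomial R0).map PowerSeries.constantCoeff).eval r} := by
    simp only [Polynomial.map_X, Polynomial.eval_X]
    exact Set.Ioi_infinite 0
  have infZ : Set.Infinite {r : ℝ | 0 < ((Polynomial.C (PowerSeries.X ^ n) - Polynomial.X : Polynomial R0).map PowerSeries.constantCoeff).eval r} := by
    have : {r : ℝ | 0 < ((Polynomial.C (PowerSeries.X ^ n) - Polynomial.X : Polynomial R0).map PowerSeries.constantCoeff).eval r} = Set.Iio 0 := by
      ext r
      simp [hn.ne']
    rw [this]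
    exact Set.Iio_infinite 0
  have n1 : ∀ s : L, -1 = s * s → GG n (p : BB) := fun s hs =>
    normL 1 (by rw [Polynomial.coe_one]; exact one_mem _) (by simp) inf1 0 zero_le_one s (by simpa using hs)
  have nx : ∀ s : L, -x = s * s → GG n (p : BB) := fun s hs =>
    normL 1 (by rw [Polynomial.coe_one]; exact one_mem _) (by simp) inf1 1 le_rfl s (by simpa using hs)
  have ny : ∀ s : L, -y = s * s → GG n (p : BB) := fun s hs =>
    normL _ hXT (by simp) infY 0 zero_le_one s (by simpa using hs)
  have nxy : ∀ s : L, -(x * y) = s * s → GG n (p : BB) := fun s hs =>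
    normL _ hXT (by simp) infY 1 le_rfl s (by simpa using hs)
  have evz : Polynomial.aeval y (Polynomial.C (PowerSeries.X ^ n) - Polynomial.X : Polynomial R0) = x ^ n - y := by
    simp [hx]
  have nz : ∀ s : L, -(x ^ n - y) = s * s → GG n (p : BB) := fun s hs =>
    normL _ hZT hZdeg.le infZ 0 zero_le_one s (by rw [evz, pow_zero, one_mul]; exact hs)
  have nxz : ∀ s : L, -(x * (x ^ n - y)) = s * s → GG n (p : BB) := fun s hs =>
    normL _ hZT hZdeg.le infZ 1 le_rfl s (by rw [evz, pow_one]; exact hs)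
  set t := y / x ^ n with ht
  have hxn : x ^ n ≠ 0 := pow_ne_zero n hx0
  have hyt : y = x ^ n * t := by rw [ht]; field_simp
  by_cases h1 : IsSmall t
  · have h2 : IsSmall (-t) := ⟨h1.1.neg, fun h => h1.2 (by rw [inv_neg] at h; simpa using h.neg)⟩
    obtain ⟨s, hs⟩ := small_sqrt _ h2
    have hzs : x ^ n - y = x ^ n * (s * s) := by rw [← hs]; linear_combination -hyt
    obtain ⟨w, h | h | h | h⟩ := no_cone_two x y hx0 hy0 (fun P hP hxP hyP => by
      refine hno P hP hxP hyP ?_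
      rw [hzs]
      exact hP.mul _ (hP.pow hxP n) _ (hP.mul_self s))
    · exact n1 w h
    · exact nx w h
    · exact ny w h
    · exact nxy w h
  by_cases h2 : IsSmall t⁻¹
  · apply small_inv_case n p hp y hy0 hmin hfr
    rw [ht, inv_div] at h2
    exact h2
  have hi : IsIntegral R0 t ∧ IsIntegral R0 t⁻¹ := by
    rcases int_or_inv t with h | h
    · exact ⟨h, not_small_iff t h1 h⟩
    · refine ⟨?_, h⟩
      have := not_small_iff _ h2 h
      rwa [inv_inv] at this
  rcases L_dich L with ⟨s, hs⟩ | ⟨-, -, -, hunit, -, -⟩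
  · exact n1 s hs
  obtain ⟨s, hs | hs⟩ := hunit t hi.1 hi.2
  · obtain ⟨w, h | h | h | h⟩ := no_cone_two x (x ^ n - y) hx0 hz0 (fun P hP hxP hzP => by
      refine hno P hP hxP ?_ hzP
      rw [hyt, hs]
      exact hP.mul _ (hP.pow hxP n) _ (hP.mul_self s))
    · exact n1 w h
    · exact nx w h
    · exact nz w h
    · exact nxz w h
  · rcases Nat.even_or_odd' n with ⟨k, hk | hk⟩
    · apply ny (x ^ k * s)
      rw [hyt, hs, hk]; ring
    · apply nxy (x ^ (k + 1) * s)
      rw [hyt, hs, hk]; ring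

end FiniteExt


/-! ### Globalisation -/

structure Good (n : ℕ) (S : Set BB) : Prop where
  cone : IsCone S
  x : bx ∈ S
  y : bY ∈ S
  z : bx ^ n - bY ∈ S

lemma Good.of_TT {n : ℕ} {S : Set BB} (h : Good n S) {a : BB} (ha : a ∈ TT n) : a ∈ S :=
  TT_le_cone h.cone h.x h.y h.z ha

lemma irreducible_dich (n : ℕ) (hn : 0 < n) (p : Polynomial R0)
    (hp : p.IsDistinguishedAt (IsLocalRing.maximalIdeal R0)) (hi : Irreducible p) :
    GG n (p : BB) ∨ ∃ S S' : Set BB, Good n S ∧ Good n S' ∧ (p : BB) ∈ S ∧ -(p : BB) ∈ S' ∧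
      ∀ r : BB, ¬ (p : BB) ∣ r → r ∈ S → r ∈ S' := by
  have injK : Function.Injective (algebraMap R0 KK) := IsFractionRing.injective R0 KK
  have hpm := hp.monic
  have hiK : Irreducible (p.map (algebraMap R0 KK)) :=
    (hpm.irreducible_iff_irreducible_map_fraction_map).1 hi
  have hp1 : 0 < p.natDegree := by
    rw [Nat.pos_iff_ne_zero]
    intro h
    rw [hpm.natDegree_eq_zero.1 h] at hi
    exact hi.not_isUnit isUnit_one
  have fact : Fact (Irreducible (p.map (algebraMap R0 KK))) := ⟨hiK⟩
  let L := AdjoinRoot (p.map (algebraMap R0 KK))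
  let pb := AdjoinRoot.powerBasis hiK.ne_zero
  have fd : FiniteDimensional KK L := pb.finite
  have hfr : Module.finrank KK L ≤ p.natDegree := by
    rw [pb.finrank, AdjoinRoot.powerBasis_dim, hpm.natDegree_map]
  let y : L := AdjoinRoot.root (p.map (algebraMap R0 KK))
  have hminK : ∀ q : Polynomial KK, Polynomial.aeval y q = 0 → p.map (algebraMap R0 KK) ∣ q := by
    intro q hq
    rw [AdjoinRoot.aeval_eq, AdjoinRoot.mk_eq_zero] at hq
    exact hq
  have hmin : ∀ q : Polynomial R0, Polynomial.aeval y q = 0 → p ∣ q := by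
    intro q hq
    rw [← Polynomial.map_dvd_map _ injK hpm]
    apply hminK
    rw [Polynomial.aeval_map_algebraMap]
    exact hq
  have hy : Polynomial.aeval y p = 0 := by
    rw [← Polynomial.aeval_map_algebraMap KK, AdjoinRoot.aeval_eq, AdjoinRoot.mk_self]
  have hgen : ∀ l : L, ∃ h : Polynomial KK, Polynomial.aeval y h = l := by
    intro l
    obtain ⟨h, hh⟩ := AdjoinRoot.mk_surjective l
    exact ⟨h, by rw [AdjoinRoot.aeval_eq, hh]⟩
  rcases local_dich n hn p hpm hp1 y hy hminK hmin hgen hfr with h | ⟨hy0, hz0, P, hP, hPx, hPy, hPz⟩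
  · exact Or.inl h
  right
  obtain ⟨ψ, hψ, hker⟩ := dist_eval hp y hy
  have hker := hker hmin
  have hpne : (p : BB) ≠ 0 := by
    rw [Ne, Polynomial.coe_eq_zero_iff]; exact hpm.ne_zero
  have hpu : ¬ IsUnit (p : BB) := by
    intro h
    have h1 := (h.map PowerSeries.constantCoeff)
    rw [← PowerSeries.coeff_zero_eq_constantCoeff_apply, Polynomial.coeff_coe] at h1
    have h2 := hp.mem (n := 0) hp1
    exact (IsLocalRing.mem_maximalIdeal _).1 h2 h1
  have hX0 : algebraMap R0 L PowerSeries.X ≠ 0 := by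
    intro h
    exact PowerSeries.X_ne_zero (R0_L_inj (L := L) (by rw [h, map_zero]))
  have hx : ψ bx = algebraMap R0 L PowerSeries.X := by
    have := hψ (Polynomial.C PowerSeries.X)
    rwa [coe_C_eq, Polynomial.aeval_C] at this
  have hyψ : ψ bY = y := by
    have := hψ Polynomial.X
    rwa [Polynomial.coe_X, Polynomial.aeval_X] at this
  have hz : ψ (bx ^ n - bY) = algebraMap R0 L PowerSeries.X ^ n - y := by
    rw [map_sub, map_pow, hx, hyψ]
  have key : ∀ ϖ : BB, ϖ ≠ 0 → ¬ IsUnit ϖ → (∀ r, (p : BB) ∣ r ↔ ϖ ∣ r) →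
      ∃ S : Set BB, Good n S ∧ ϖ ∈ S ∧ ∀ r, ψ r ∈ P → ψ r ≠ 0 → r ∈ S := by
    intro ϖ h0 hu hd
    obtain ⟨S, hS, h1, h2⟩ := cone_lift ψ ϖ h0 (fun r => by rw [hker, hd])
      (fun r hr => FiniteMultiplicity.of_not_isUnit hu hr) hP
    refine ⟨S, ⟨hS, h1 _ ?_ ?_, h1 _ ?_ ?_, h1 _ ?_ ?_⟩, h2, h1⟩
    · rw [hx]; exact hPx
    · rw [hx]; exact hX0
    · rw [hyψ]; exact hPy
    · rw [hyψ]; exact hy0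
    · rw [hz]; exact hPz
    · rw [hz]; exact hz0
  obtain ⟨S, hS, hpS, hS1⟩ := key p hpne hpu (fun r => Iff.rfl)
  obtain ⟨S', hS', hpS', hS1'⟩ := key (-p) (neg_ne_zero.2 hpne) (by rwa [IsUnit.neg_iff])
    (fun r => by rw [neg_dvd])
  refine ⟨S, S', hS, hS', hpS, hpS', fun r hr hrS => ?_⟩
  have hψr : ψ r ≠ 0 := by rw [Ne, hker]; exact hr
  rcases hP.total (ψ r) with h | h
  · exact hS1' r h hψr
  · exfalso
    have h1 := hS1 (-r) (by rwa [map_neg]) (by rw [map_neg]; exact neg_ne_zero.2 hψr)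
    have := hS.cone.anti r hrS h1
    rw [this] at hr
    exact hr (dvd_zero _)

lemma dist_factor (W p V : Polynomial R0) (hW : W.IsDistinguishedAt (IsLocalRing.maximalIdeal R0))
    (hp : p.Monic) (h : W = p * V) : p.IsDistinguishedAt (IsLocalRing.maximalIdeal R0) := by
  refine ⟨⟨?_⟩, hp⟩
  have hWm : W.map PowerSeries.constantCoeff = Polynomial.X ^ W.natDegree := by
    ext i
    rw [Polynomial.coeff_map, Polynomial.coeff_X_pow]
    rcases lt_trichotomy i W.natDegree with h1 | h1 | h1
    · rw [if_neg h1.ne]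
      have := hW.mem h1
      rw [R0_mem_max, PowerSeries.X_dvd_iff] at this
      exact this
    · rw [if_pos h1, h1, Polynomial.coeff_natDegree, hW.monic.leadingCoeff, map_one]
    · rw [if_neg h1.ne', Polynomial.coeff_eq_zero_of_natDegree_lt h1, map_zero]
  have hd : p.map PowerSeries.constantCoeff ∣ (Polynomial.X : Polynomial ℝ) ^ W.natDegree := by
    rw [← hWm, h, Polynomial.map_mul]
    exact dvd_mul_right _ _
  obtain ⟨i, -, hi⟩ := (dvd_prime_pow Polynomial.prime_X _).1 hd
  have heq := Polynomial.eq_of_monic_of_associated (hp.map _) (Polynomial.monic_X_pow i) hi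
  have hdeg : p.natDegree = i := by
    rw [← hp.natDegree_map (PowerSeries.constantCoeff (R := ℝ)), heq, Polynomial.natDegree_X_pow]
  intro k hk
  rw [R0_mem_max, PowerSeries.X_dvd_iff, ← Polynomial.coeff_map, heq, Polynomial.coeff_X_pow,
    if_neg (by omega)]

/-- constant sign on all good cones -/
def CS (n : ℕ) (a : BB) : Prop := (∀ S, Good n S → a ∈ S) ∨ (∀ S, Good n S → -a ∈ S)

lemma CS.cancel_pos {n : ℕ} {a b : BB} (ha : ∀ S, Good n S → a ∈ S) (ha0 : a ≠ 0) (h : CS n (a * b)) :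
    CS n b := by
  rcases h with h | h
  · left; intro S hS; exact hS.cone.cancel (ha S hS) ha0 (h S hS)
  · right; intro S hS
    have h1 := h S hS
    rw [← mul_neg] at h1
    exact hS.cone.cancel (ha S hS) ha0 h1

lemma CS.neg {n : ℕ} {a : BB} (h : CS n (-a)) : CS n a := by
  rcases h with h | h
  · exact Or.inr h
  · left; intro S hS; simpa using h S hS

lemma CS.cancel_GG {n : ℕ} {a b : BB} (ha : GG n a) (ha0 : a ≠ 0) (h : CS n (a * b)) :
    CS n b := by
  rcases ha with ha | ha
  · exact CS.cancel_pos (fun S hS => hS.of_TT ha) ha0 h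
  · apply CS.neg
    refine CS.cancel_pos (fun S hS => hS.of_TT ha) (neg_ne_zero.2 ha0) ?_
    rwa [neg_mul_neg]

lemma global_ind (n : ℕ) (hn : 0 < n) (d : ℕ) : ∀ W : Polynomial R0, W.natDegree = d →
    W.IsDistinguishedAt (IsLocalRing.maximalIdeal R0) → CS n (W : BB) → GG n (W : BB) := by
  induction d using Nat.strong_induction_on with
  | _ d ih =>
  intro W hd hW hcs
  by_cases hd0 : W.natDegree = 0
  · rw [hW.monic.natDegree_eq_zero.1 hd0, Polynomial.coe_one]
    exact Or.inl (one_mem _)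
  have hWu : ¬ IsUnit W := by
    intro h
    exact hd0 (by rw [hW.monic.eq_one_of_isUnit h, Polynomial.natDegree_one])
  obtain ⟨p0, hp0, V0, hV0⟩ := WfDvdMonoid.exists_irreducible_factor hWu hW.monic.ne_zero
  obtain ⟨p, hpm, hpi, V, hV⟩ : ∃ p : Polynomial R0, p.Monic ∧ Irreducible p ∧ p ∣ W := by
    have hu : p0.leadingCoeff * V0.leadingCoeff = 1 := by
      rw [← Polynomial.leadingCoeff_mul, ← hV0, hW.monic.leadingCoeff]
    have hu' : V0.leadingCoeff * p0.leadingCoeff = 1 := by rw [mul_comm]; exact hu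
    have hCu : IsUnit (Polynomial.C V0.leadingCoeff) := Polynomial.isUnit_C.2 (IsUnit.of_mul_eq_one _ hu')
    refine ⟨Polynomial.C V0.leadingCoeff * p0, Polynomial.monic_C_mul_of_mul_leadingCoeff_eq_one hu',
      ?_, ?_⟩
    · rw [irreducible_isUnit_mul hCu]; exact hp0
    · rw [hCu.mul_left_dvd]; exact ⟨V0, hV0⟩
  have hpd := dist_factor W p V hW hpm hV
  have hVm : V.Monic := hpm.of_mul_monic_left (by rw [← hV]; exact hW.monic)
  have hVd := dist_factor W V p hW hVm (by rw [hV, mul_comm])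
  have hp1 : 0 < p.natDegree := by
    rw [Nat.pos_iff_ne_zero]
    intro h
    rw [hpm.natDegree_eq_zero.1 h] at hpi
    exact hpi.not_isUnit isUnit_one
  have hdeg : W.natDegree = p.natDegree + V.natDegree := by rw [hV, hpm.natDegree_mul hVm]
  have hpne : (p : BB) ≠ 0 := by
    rw [Ne, Polynomial.coe_eq_zero_iff]; exact hpm.ne_zero
  have hVne : (V : BB) ≠ 0 := by
    rw [Ne, Polynomial.coe_eq_zero_iff]; exact hVm.ne_zero
  rw [hV, Polynomial.coe_mul] at hcs ⊢
  rcases irreducible_dich n hn p hpd hpi with hG | ⟨S, S', hS, hS', hpS, hpS', htr⟩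
  · exact hG.mul (ih V.natDegree (by omega) V rfl hVd (hcs.cancel_GG hG hpne))
  have hpV : (p : BB) ∣ V := by
    by_contra hnd
    have hnd' : ¬ (p : BB) ∣ -(V : BB) := by rwa [dvd_neg]
    apply hVne
    have hp0' : -(p : BB) ≠ 0 := neg_ne_zero.2 hpne
    rcases hcs with h | h
    · have h1 := htr _ hnd (hS.cone.cancel hpS hpne (h S hS))
      have h2 := h S' hS'
      rw [← neg_mul_neg] at h2
      exact hS'.cone.anti _ h1 (hS'.cone.cancel hpS' hp0' h2)
    · have h0 := h S hS
      rw [← mul_neg] at h0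
      have h1 := htr _ hnd' (hS.cone.cancel hpS hpne h0)
      have h2 := h S' hS'
      rw [← neg_mul] at h2
      exact hS'.cone.anti _ (hS'.cone.cancel hpS' hp0' h2) h1
  obtain ⟨V', hV'⟩ := dist_dvd hpd hpV
  have hVm' : V'.Monic := hpm.of_mul_monic_left (by rw [← hV']; exact hVm)
  have hVd' := dist_factor V V' p hVd hVm' (by rw [hV', mul_comm])
  have hdeg' : V.natDegree = p.natDegree + V'.natDegree := by rw [hV', hpm.natDegree_mul hVm']
  rw [hV', Polynomial.coe_mul, ← mul_assoc] at hcs ⊢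
  have hG : GG n ((p : BB) * p) := Or.inl (TT_sq n _)
  exact hG.mul (ih V'.natDegree (by omega) V' rfl hVd' (hcs.cancel_GG hG (mul_ne_zero hpne hpne)))

lemma main_BB (n : ℕ) (hn : 0 < n) (f : BB)
    (hf : ∀ S : Set BB, IsCone S → bx ∈ S → bY ∈ S → bx ^ n - bY ∈ S → f ∈ S) : f ∈ TT n := by
  by_cases hf0 : f = 0
  · rw [hf0]; exact zero_mem _
  have hbx0 : bx ≠ 0 := fun h => PowerSeries.X_ne_zero (PowerSeries.C_injective (h.trans (map_zero _).symm))
  have hbxu : ¬ IsUnit bx := by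
    intro h
    have := h.map (PowerSeries.constantCoeff (R := R0))
    rw [PowerSeries.constantCoeff_C] at this
    exact PowerSeries.X_prime.not_isUnit this
  obtain ⟨f', hf', hnd⟩ := (FiniteMultiplicity.of_not_isUnit hbxu hf0).exists_eq_pow_mul_and_not_dvd
  set j := multiplicity bx f
  have hne : f'.map (IsLocalRing.residue R0) ≠ 0 := by
    intro h
    apply hnd
    have h1 : ∀ i, ∃ c : R0, PowerSeries.coeff i f' = PowerSeries.X * c := by
      intro i
      have h2 := congrArg (PowerSeries.coeff i) h
      rw [PowerSeries.coeff_map, map_zero, IsLocalRing.residue_eq_zero_iff, R0_mem_max] at h2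
      exact h2
    choose c hc using h1
    refine ⟨PowerSeries.mk c, ?_⟩
    ext1 i
    rw [PowerSeries.coeff_C_mul, PowerSeries.coeff_mk, hc]
  obtain ⟨W, h, H⟩ := PowerSeries.exists_isWeierstrassFactorization hne
  have hGx : GG n (bx ^ j) := Or.inl (pow_mem (TT_x n) _)
  have hGh : GG n h := GG_unit n h H.isUnit
  have hcs : CS n f := Or.inl fun S hS => hf S hS.cone hS.x hS.y hS.z
  have hGf : GG n f := by
    rw [hf', H.eq_mul] at hcs ⊢
    refine hGx.mul (GG.mul ?_ hGh)
    apply global_ind n hn _ W rfl H.isDistinguishedAt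
    have h1 := hcs.cancel_GG hGx (pow_ne_zero _ hbx0)
    rw [mul_comm] at h1
    exact h1.cancel_GG hGh H.isUnit.ne_zero
  rcases hGf with h1 | h1
  · exact h1
  · exfalso
    obtain ⟨S, hS, hx, hy, hz⟩ := exists_S0 n
    exact hf0 (hS.anti f (hf S hS hx hy hz) (TT_le_cone hS hx hy hz h1))


/-- Let `n ≥ 1`. If `f ∈ ℝ[[x,y]]` is nonnegative at every ordering of
`ℝ((x,y))` at which `x > 0`, `y > 0` and `x^n − y > 0`, then `f` lies in the preordering
of `ℝ[[x,y]]` generated by `x`, `y` and `x^n − y`. -/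
theorem psd_cusp_implies_preordering (n : ℕ) (hn : 0 < n) (f : PS)
    (hf : ∀ P : Set FF, IsOrderingF P → (ι psX ∈ P ∧ ι psX ≠ 0) →
      (ι psY ∈ P ∧ ι psY ≠ 0) →
      (ι (psX ^ n - psY) ∈ P ∧ ι (psX ^ n - psY) ≠ 0) → ι f ∈ P) :
    f ∈ preorderingGen {psX, psY, psX ^ n - psY} := by
  exact reduction n (fun f h => main_BB n hn f h) f hf
end
end

section
/- Let n be an odd integer with n ≥ 3. Then: at every ordering of the field ℝ((x,y)) at which y ≥ 0 and x^n − y ≥ 0, one also has x ≥ 0; but nevertheless x does not belong to the preordering of ℝ[[x,y]] generated by y and x^n − y. -/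
noncomputable section

open MvPowerSeries MvPolynomial

lemma coeff_e_mul (f g : PS) :
    MvPowerSeries.coeff (Finsupp.single (0 : Fin 2) 1) (f * g) =
      MvPowerSeries.constantCoeff f * MvPowerSeries.coeff (Finsupp.single (0 : Fin 2) 1) g +
      MvPowerSeries.coeff (Finsupp.single (0 : Fin 2) 1) f * MvPowerSeries.constantCoeff g := by
  classical
  rw [MvPowerSeries.coeff_mul, Finsupp.antidiagonal_single]
  simp [Finset.Nat.antidiagonal_succ]

/-- Series with nonnegative constant term, whose `x`-coefficient vanishes if the
constant term does. -/
def goodSemiring : Subsemiring PS where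
  carrier := {f | 0 ≤ MvPowerSeries.constantCoeff f ∧ (MvPowerSeries.constantCoeff f = 0 →
    MvPowerSeries.coeff (Finsupp.single (0 : Fin 2) 1) f = 0)}
  zero_mem' := by simp
  one_mem' := by simp
  add_mem' := by
    rintro f g ⟨hf, hf'⟩ ⟨hg, hg'⟩
    refine ⟨by simpa using add_nonneg hf hg, fun h => ?_⟩
    rw [map_add] at h
    rw [map_add, hf' (by linarith), hg' (by linarith), add_zero]
  mul_mem' := by
    rintro f g ⟨hf, hf'⟩ ⟨hg, hg'⟩
    refine ⟨by simpa using mul_nonneg hf hg, fun h => ?_⟩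
    rw [map_mul] at h
    rw [coeff_e_mul]
    rcases mul_eq_zero.mp h with h | h
    · rw [h, hf' h]; ring
    · rw [h, hg' h]; ring

/-- Let `n` be odd, `n ≥ 3`. At every ordering of `ℝ((x,y))` at which
`y ≥ 0` and `x^n − y ≥ 0` one also has `x ≥ 0`; but `x` is not in the preordering of
`ℝ[[x,y]]` generated by `y` and `x^n − y`. -/
theorem x_nonneg_but_not_in_preordering (n : ℕ) (hodd : Odd n) (hn : 3 ≤ n) :
    (∀ P : Set FF, IsOrderingF P → ι psY ∈ P → ι (psX ^ n - psY) ∈ P → ι psX ∈ P) ∧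
      psX ∉ preorderingGen {psY, psX ^ n - psY} := by
  constructor
  · rintro P ⟨hadd, hmul, htot, hanti⟩ hy hxy
    rcases htot (ι psX) with h | h
    · exact h
    have hone : (1 : FF) ∈ P := by
      rcases htot 1 with h1 | h1
      · exact h1
      · simpa using hmul _ h1 _ h1
    have hpow : ∀ k : ℕ, (-(ι psX)) ^ k ∈ P := by
      intro k
      induction k with
      | zero => simpa using hone
      | succ k ih => rw [pow_succ]; exact hmul _ ih _ h
    have h1 := hpow n
    rw [hodd.neg_pow] at h1
    have h2 := hadd _ hxy _ hy
    rw [← map_add, sub_add_cancel, map_pow] at h2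
    have h3 : ι psX = 0 := eq_zero_of_pow_eq_zero (hanti _ h2 h1)
    rw [h3] at h ⊢
    simpa using h
  · intro hx
    have hle : Subsemiring.closure (({psY, psX ^ n - psY} : Set PS) ∪ {a | ∃ b, a = b ^ 2})
        ≤ goodSemiring := by
      rw [Subsemiring.closure_le]
      have hX0 : MvPowerSeries.constantCoeff psX = 0 := MvPowerSeries.constantCoeff_X _
      have hY0 : MvPowerSeries.constantCoeff psY = 0 := MvPowerSeries.constantCoeff_X _
      have hY1 : MvPowerSeries.coeff (Finsupp.single (0 : Fin 2) 1) psY = 0 := by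
        classical
        rw [MvPowerSeries.coeff_X, if_neg]
        intro h
        have := DFunLike.congr_fun h 0
        simp at this
      rintro f ((rfl | rfl) | ⟨b, rfl⟩)
      · exact ⟨hY0.ge, fun _ => hY1⟩
      · obtain ⟨m, rfl⟩ : ∃ m, n = m + 2 := ⟨n - 2, by omega⟩
        refine ⟨by simp [hX0, hY0], fun _ => ?_⟩
        rw [map_sub, hY1, pow_succ, coeff_e_mul, map_pow, hX0]
        simp
      · refine ⟨by rw [map_pow]; positivity, fun h => ?_⟩
        rw [map_pow] at h
        have h0 : MvPowerSeries.constantCoeff b = 0 := eq_zero_of_pow_eq_zero h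
        rw [pow_two, coeff_e_mul, h0]; ring
    have := (hle hx).2 (MvPowerSeries.constantCoeff_X _)
    simp at this
end
end

section
/- Let n be an odd integer with n ≥ 3. Then: at every ordering of the field ℝ((x,y)) at which x^n − y² ≥ 0, one also has x ≥ 0; but nevertheless x does not belong to the preordering of ℝ[[x,y]] generated by x^n − y². -/
noncomputable section

open MvPowerSeries MvPolynomial

lemma coeff_x_mul (f g : PS) : MvPowerSeries.coeff (Finsupp.single (0 : Fin 2) 1) (f * g) =
    MvPowerSeries.coeff 0 f * MvPowerSeries.coeff (Finsupp.single (0 : Fin 2) 1) g +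
    MvPowerSeries.coeff (Finsupp.single (0 : Fin 2) 1) f * MvPowerSeries.coeff 0 g := by
  classical
  rw [MvPowerSeries.coeff_mul, Finsupp.antidiagonal_single]
  rw [Finset.sum_map]
  simp [Finset.Nat.antidiagonal_succ]

lemma coeff_zero_mul' (f g : PS) : MvPowerSeries.coeff 0 (f * g) =
    MvPowerSeries.coeff 0 f * MvPowerSeries.coeff 0 g := by
  simp

/-- Invariant of the preordering. -/
lemma invariant (n : ℕ) (hn : 3 ≤ n) (f : PS)
    (hf : f ∈ preorderingGen {psX ^ n - psY ^ 2}) :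
    0 ≤ MvPowerSeries.coeff 0 f ∧
      (MvPowerSeries.coeff 0 f = 0 →
        MvPowerSeries.coeff (Finsupp.single (0 : Fin 2) 1) f = 0) := by
  classical
  have key : ∀ b : PS, 0 ≤ MvPowerSeries.coeff 0 (b ^ 2) ∧
      (MvPowerSeries.coeff 0 (b ^ 2) = 0 →
        MvPowerSeries.coeff (Finsupp.single (0 : Fin 2) 1) (b ^ 2) = 0) := by
    intro b
    rw [pow_two, coeff_x_mul, coeff_zero_mul']
    refine ⟨mul_self_nonneg _, fun h => ?_⟩
    rw [mul_self_eq_zero.mp h]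
    simp
  change f ∈ Subsemiring.closure _ at hf
  induction hf using Subsemiring.closure_induction with
  | mem a ha =>
    rcases ha with ha | ⟨b, rfl⟩
    · rw [Set.mem_singleton_iff] at ha
      obtain ⟨m, rfl⟩ : ∃ m, n = m + 2 := ⟨n - 2, by omega⟩
      have hm : m ≠ 0 := by omega
      subst ha
      rw [pow_succ, pow_succ, pow_two, map_sub, map_sub, coeff_x_mul, coeff_x_mul,
        coeff_x_mul, coeff_zero_mul', coeff_zero_mul', coeff_zero_mul']
      simp [hm]
    · exact key b
  | zero => simp
  | one => simpa using key 1
  | add a b _ _ ha hb =>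
    rw [map_add, map_add]
    refine ⟨add_nonneg ha.1 hb.1, fun h => ?_⟩
    have h1 := ha.1
    have h2 := hb.1
    rw [ha.2 (by linarith), hb.2 (by linarith), add_zero]
  | mul a b _ _ ha hb =>
    rw [coeff_x_mul, coeff_zero_mul']
    refine ⟨mul_nonneg ha.1 hb.1, fun h => ?_⟩
    rcases mul_eq_zero.mp h with h | h
    · rw [h, ha.2 h]; simp
    · rw [h, hb.2 h]; simp

/-- Let `n` be odd, `n ≥ 3`. At every ordering of `ℝ((x,y))` at which
`x^n − y² ≥ 0` one also has `x ≥ 0`; but `x` is not in the preordering of `ℝ[[x,y]]`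
generated by `x^n − y²`. -/
theorem x_nonneg_but_not_in_preordering' (n : ℕ) (hodd : Odd n) (hn : 3 ≤ n) :
    (∀ P : Set FF, IsOrderingF P → ι (psX ^ n - psY ^ 2) ∈ P → ι psX ∈ P) ∧
      psX ∉ preorderingGen {psX ^ n - psY ^ 2} := by
  refine ⟨?_, ?_⟩
  · rintro P ⟨hadd, hmul, htot, hanti⟩ h
    have hsq : ∀ a : FF, a ^ 2 ∈ P := by
      intro a
      rcases htot a with ha | ha
      · simpa [pow_two] using hmul a ha a ha
      · simpa [pow_two] using hmul _ ha _ ha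
    rcases htot (ι psX) with hx | hx
    · exact hx
    obtain ⟨k, rfl⟩ := hodd
    have h1 := hadd _ h _ (hsq (ι psY))
    have e : ι (psX ^ (2 * k + 1) - psY ^ 2) + ι psY ^ 2 = ι psX ^ (2 * k + 1) := by
      rw [map_sub, map_pow, map_pow]; ring
    rw [e] at h1
    have h2 := hmul _ hx _ (hsq (ι psX ^ k))
    have e2 : -ι psX * (ι psX ^ k) ^ 2 = -(ι psX ^ (2 * k + 1)) := by ring
    rw [e2] at h2
    have h3 := pow_eq_zero_iff (by omega) |>.mp (hanti _ h1 h2)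
    rw [h3] at hx ⊢
    simpa using hx
  · intro h
    have := (invariant n hn psX h).2 (by simp)
    simp [MvPowerSeries.coeff_X] at this
end
end

section
/- Let f ∈ ℝ[[x,y]] be a formal power series in two variables. If f is nonnegative at every ordering of the field ℝ((x,y)), then f is a sum of two squares in ℝ[[x,y]], i.e., f = g² + h² for some g, h ∈ ℝ[[x,y]]. -/
noncomputable section

open MvPowerSeries MvPolynomial

lemma fr_core {K : Type*} [Field K] (ρ : ℝ →+* K) (N : K → ℝ)
    (hmul : ∀ a b, N (a * b) = N a * N b) (hadd : ∀ a b, N (a + b) ≤ max (N a) (N b))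
    (h0 : N 0 = 0) (hpos : ∀ a, a ≠ 0 → 0 < N a)
    (hreal : ∀ r : ℝ, r ≠ 0 → N (ρ r) = 1)
    (hres : ∀ a : K, N a ≤ 1 → ∃ r : ℝ, N (a - ρ r) < 1) : IsFormallyReal K := by
  have hN1 : N 1 = 1 := by simpa using hreal 1 one_ne_zero
  have hle : ∀ r : ℝ, N (ρ r) ≤ 1 := by
    intro r
    by_cases h : r = 0
    · simp [h, h0]
    · exact (hreal r h).le
  have hnn : ∀ a, 0 ≤ N a := by
    intro a
    by_cases h : a = 0
    · simp [h, h0]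
    · exact (hpos a h).le
  have key : ∀ s : K, IsSumNonzeroSq s →
      ∃ c : K, c ≠ 0 ∧ ∃ r : ℝ, 0 < r ∧ N (s / c ^ 2 - ρ r) < 1 := by
    intro s hs
    induction hs with
    | @sq a ha =>
      refine ⟨a, ha, 1, one_pos, ?_⟩
      have : a * a / a ^ 2 - ρ 1 = 0 := by simp; field_simp; simp
      rw [this, h0]; exact one_pos
    | @sq_add a s ha hs ih =>
      obtain ⟨c, hc, r, hr, h⟩ := ih
      rcases le_or_gt (N a) (N c) with hac | hac
      · have h1 : N (a / c) ≤ 1 := by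
          have : N (a / c) * N c = N a := by rw [← hmul]; congr 1; field_simp
          by_contra hcon
          push Not at hcon
          nlinarith [hpos c hc]
        obtain ⟨t, ht⟩ := hres _ h1
        refine ⟨c, hc, t ^ 2 + r, by positivity, ?_⟩
        have e : (a * a + s) / c ^ 2 - ρ (t ^ 2 + r)
            = (a / c - ρ t) * (a / c + ρ t) + (s / c ^ 2 - ρ r) := by
          simp only [map_add, map_pow]; field_simp; ring
        rw [e]
        refine lt_of_le_of_lt (hadd _ _) (max_lt ?_ h)
        rw [hmul]
        have : N (a / c + ρ t) ≤ 1 := (hadd _ _).trans (max_le h1 (hle t))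
        nlinarith [hnn (a / c - ρ t), hnn (a / c + ρ t)]
      · refine ⟨a, ha, 1, one_pos, ?_⟩
        have h1 : N (c / a) < 1 := by
          have : N (c / a) * N a = N c := by rw [← hmul]; congr 1; field_simp
          by_contra hcon
          push Not at hcon
          nlinarith [hpos a ha]
        have h2 : N (s / c ^ 2) ≤ 1 := by
          have : s / c ^ 2 = (s / c ^ 2 - ρ r) + ρ r := by ring
          rw [this]
          exact (hadd _ _).trans (max_le h.le (hle r))
        have e : (a * a + s) / a ^ 2 - ρ 1 = (s / c ^ 2) * ((c / a) * (c / a)) := by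
          simp only [map_one]; field_simp; ring
        rw [e, hmul, hmul]
        have h3 : N (c / a) * N (c / a) < 1 := by nlinarith [hnn (c / a)]
        nlinarith [hnn (s / c ^ 2), mul_nonneg (hnn (c / a)) (hnn (c / a))]
  refine ⟨fun h => ?_⟩
  obtain ⟨c, hc, r, hr, h⟩ := key 0 h
  have : N (-(ρ r)) = 1 := by
    rw [← map_neg]; exact hreal _ (by linarith [hr] : -r < 0).ne
  simp [this] at h

lemma conj_core {K L : Type*} [Field K] [Field L] [Algebra K L] (ρ : ℝ →+* K) (N : L → ℝ)
    (hmul : ∀ a b, N (a * b) = N a * N b) (hadd : ∀ a b, N (a + b) ≤ max (N a) (N b))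
    (hnn : ∀ a, 0 ≤ N a)
    (hreal : ∀ r : ℝ, r ≠ 0 → N (algebraMap K L (ρ r)) = 1)
    (i : L) (hi : i ^ 2 = -1) (σ : L →+* L) (hσ : ∀ a, N (σ a) = N a)
    (hσK : ∀ a : K, σ (algebraMap K L a) = algebraMap K L a) (hσi : σ i = - i)
    (a : K) (Q : Polynomial ℝ) (hQ : Q.Monic)
    (hQa : N (Q.eval₂ ((algebraMap K L).comp ρ) (algebraMap K L a)) < 1) :
    ∃ r : ℝ, N (algebraMap K L (a - ρ r)) < 1 := by
  let : Algebra ℝ L := ((algebraMap K L).comp ρ).toAlgebra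
  have halg : ∀ r, algebraMap ℝ L r = algebraMap K L (ρ r) := fun r => rfl
  let j : ℂ →ₐ[ℝ] L := Complex.liftAux i (by rw [← hi]; ring)
  have hj : ∀ z : ℂ, j z = algebraMap K L (ρ z.re) + algebraMap K L (ρ z.im) * i := by
    intro z
    simp [j, Complex.liftAux_apply, Algebra.smul_def, halg]
  have hN1 : N 1 = 1 := by simpa using hreal 1 one_ne_zero
  -- some root is close
  have hz : ∃ z : ℂ, N (algebraMap K L a - j z) < 1 := by
    by_contra hcon
    push Not at hcon
    have hs : (Q.map (algebraMap ℝ ℂ)).Splits := IsAlgClosed.splits _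
    have hm : (Q.map (algebraMap ℝ ℂ)).Monic := hQ.map _
    have e1 := hs.eq_prod_roots_of_monic hm
    have e2 : Q.eval₂ ((algebraMap K L).comp ρ) (algebraMap K L a)
        = (Q.map (algebraMap ℝ ℂ)).eval₂ (j : ℂ →+* L) (algebraMap K L a) := by
      rw [Polynomial.eval₂_map]
      congr 1
      ext r
      simp [halg]
    have e3 : ∀ s : Multiset ℂ, 1 ≤ N (((s.map fun z => Polynomial.X - Polynomial.C z).prod).eval₂ (j : ℂ →+* L) (algebraMap K L a)) := by
      intro s
      induction s using Multiset.induction with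
      | empty => simp [hN1]
      | cons z s ih =>
        simp only [Multiset.map_cons, Multiset.prod_cons, Polynomial.eval₂_mul, hmul]
        have : 1 ≤ N ((Polynomial.X - Polynomial.C z : Polynomial ℂ).eval₂ (j : ℂ →+* L) (algebraMap K L a)) := by
          simpa using hcon z
        nlinarith
    rw [e2, e1] at hQa
    exact absurd hQa (not_lt.mpr (e3 _))
  obtain ⟨z, hz⟩ := hz
  by_cases him : z.im = 0
  · refine ⟨z.re, ?_⟩
    rw [hj, him] at hz
    simpa using hz
  · exfalso
    have hneg : ∀ x, N (-x) = N x := by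
      intro x
      have h1 : N (-1) = 1 := by simpa using hreal (-1) (by norm_num)
      rw [← neg_one_mul, hmul, h1, one_mul]
    have hc : N (algebraMap K L a - (algebraMap K L (ρ z.re) - algebraMap K L (ρ z.im) * i)) < 1 := by
      rw [← hσ] at hz
      rw [hj] at hz
      simpa [hσK, hσi, sub_eq_add_neg] using hz
    rw [hj] at hz
    have h2 := hadd (algebraMap K L a - (algebraMap K L (ρ z.re) - algebraMap K L (ρ z.im) * i))
      (-(algebraMap K L a - (algebraMap K L (ρ z.re) + algebraMap K L (ρ z.im) * i)))
    have e : (algebraMap K L a - (algebraMap K L (ρ z.re) - algebraMap K L (ρ z.im) * i)) +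
      (-(algebraMap K L a - (algebraMap K L (ρ z.re) + algebraMap K L (ρ z.im) * i)))
      = algebraMap K L (ρ (2 * z.im)) * i := by rw [two_mul]; simp; ring
    have hNi : N i = 1 := by
      have h1 : N (-1) = 1 := by simpa using hreal (-1) (by norm_num)
      rw [← hi, pow_two, hmul] at h1
      nlinarith [hnn i]
    rw [e, hmul, hNi, hreal _ (by simpa using him), hneg] at h2
    have := max_lt hc hz
    linarith

lemma fr_of_no_i {F K : Type*} [NontriviallyNormedField F] [IsUltrametricDist F] [CompleteSpace F]
    [Field K] [Algebra F K] [FiniteDimensional F K] (ρ : ℝ →+* F)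
    (hreal : ∀ r : ℝ, r ≠ 0 → ‖ρ r‖ = 1)
    (hres : ∀ a : F, ‖a‖ ≤ 1 → ∃ r : ℝ, ‖a - ρ r‖ < 1)
    (hi : ∀ a : K, a ^ 2 ≠ -1) : IsFormallyReal K := by
  have hirr : Irreducible (Polynomial.X ^ 2 + 1 : Polynomial K) := by
    have hd : (Polynomial.X ^ 2 + 1 : Polynomial K).natDegree = 2 := by compute_degree!
    rw [Polynomial.irreducible_iff_roots_eq_zero_of_degree_le_three (by omega) (by omega)]
    rw [Multiset.eq_zero_iff_forall_notMem]
    intro a ha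
    have := (Polynomial.mem_roots'.mp ha).2
    simp at this
    exact hi a (eq_neg_of_add_eq_zero_left this)
  have : Fact (Irreducible (Polynomial.X ^ 2 + 1 : Polynomial K)) := ⟨hirr⟩
  let L := AdjoinRoot (Polynomial.X ^ 2 + 1 : Polynomial K)
  have : FiniteDimensional K L := by
    have : (Polynomial.X ^ 2 + 1 : Polynomial K).Monic := by monicity!
    exact this.finite_adjoinRoot
  have : FiniteDimensional F L := FiniteDimensional.trans F K L
  let i : L := AdjoinRoot.root _
  have hii : i ^ 2 = -1 := by
    have := AdjoinRoot.eval₂_root (Polynomial.X ^ 2 + 1 : Polynomial K)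
    simp at this
    exact eq_neg_of_add_eq_zero_left this
  have hroot : Polynomial.eval₂ (Algebra.ofId K L : K →+* L) (-i) (Polynomial.X ^ 2 + 1) = 0 := by
    simp [hii]
  let σ : L →ₐ[K] L := AdjoinRoot.liftAlgHom _ (Algebra.ofId K L) (-i) hroot
  let N : L → ℝ := spectralNorm F L
  have hmul : ∀ a b, N (a * b) = N a * N b := fun a b => map_mul (spectralMulAlgNorm F L) a b
  have hadd : ∀ a b, N (a + b) ≤ max (N a) (N b) := isNonarchimedean_spectralNorm
  have hN0 : N 0 = 0 := spectralNorm_zero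
  have hnn : ∀ a, 0 ≤ N a := spectralNorm_nonneg
  have hF : ∀ c : F, N (algebraMap F L c) = ‖c‖ := spectralNorm_extends
  have hN1 : N 1 = 1 := spectralNorm_one
  have hσ : ∀ a, N (σ a) = N a := by
    intro a
    change spectralValue _ = spectralValue _
    have := minpoly.algHom_eq (σ.restrictScalars F) (σ : L →+* L).injective a
    simpa using congrArg spectralValue this
  have htow : ∀ c, algebraMap K L (algebraMap F K c) = algebraMap F L c := fun c =>
    (IsScalarTower.algebraMap_apply F K L c).symm
  apply fr_core ((algebraMap F K).comp ρ) (fun a => N (algebraMap K L a))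
  · intro a b; rw [map_mul, hmul]
  · intro a b; rw [map_add]; exact hadd _ _
  · simp [hN0]
  · intro a ha
    exact spectralNorm_zero_lt (by simpa using ha) (Algebra.IsAlgebraic.isAlgebraic _)
  · intro r hr
    simp [htow, hF, hreal r hr]
  · intro a ha
    have hinteg : IsIntegral F (algebraMap K L a) := Algebra.IsIntegral.isIntegral _
    have hmon := minpoly.monic hinteg
    have hc := (spectralValue_le_one_iff hmon).mp ha
    choose r hr using fun n => hres _ (hc n)
    set P := minpoly F (algebraMap K L a) with hP
    let Q : Polynomial ℝ := Polynomial.X ^ P.natDegree +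
      ∑ n ∈ Finset.range P.natDegree, Polynomial.C (r n) * Polynomial.X ^ n
    have hQ : Q.Monic := by
      apply Polynomial.monic_X_pow_add
      refine lt_of_le_of_lt (Polynomial.degree_sum_le _ _) ?_
      rw [Finset.sup_lt_iff (WithBot.bot_lt_coe _)]
      intro n hn
      exact lt_of_le_of_lt (Polynomial.degree_C_mul_X_pow_le _ _) (by simpa using hn)
    refine conj_core ((algebraMap F K).comp ρ) N hmul hadd hnn ?_ i hii σ hσ ?_ ?_ a Q hQ ?_
    · intro r hr
      simp [htow, hF, hreal r hr]
    · intro a; simp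
    · exact AdjoinRoot.liftAlgHom_root (h := hroot) ..
    · have e0 : P.eval₂ (algebraMap F L) (algebraMap K L a) = 0 := minpoly.aeval _ _
      have e1 : P.eval₂ (algebraMap F L) (algebraMap K L a) = (algebraMap K L a) ^ P.natDegree
          + ∑ n ∈ Finset.range P.natDegree, algebraMap F L (P.coeff n) * (algebraMap K L a) ^ n := by
        rw [Polynomial.eval₂_eq_sum_range, Finset.sum_range_succ, add_comm, hmon.coeff_natDegree]
        simp
      have e2 : Q.eval₂ ((algebraMap K L).comp ((algebraMap F K).comp ρ)) (algebraMap K L a) =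
          ∑ n ∈ Finset.range P.natDegree, algebraMap F L (-(P.coeff n - ρ (r n))) * (algebraMap K L a) ^ n := by
        rw [← sub_zero (Polynomial.eval₂ _ _ _), ← e0, e1]
        simp only [Q, Polynomial.eval₂_add, Polynomial.eval₂_finsetSum, Polynomial.eval₂_mul, Polynomial.eval₂_C, Polynomial.eval₂_X_pow, RingHom.comp_apply, htow, add_sub_add_left_eq_sub]
        rw [← Finset.sum_sub_distrib]
        apply Finset.sum_congr rfl
        intro n _
        simp only [map_neg, map_sub]; ring
      rw [e2]
      have hsum : ∀ s : Finset ℕ, N (∑ n ∈ s, algebraMap F L (-(P.coeff n - ρ (r n))) * (algebraMap K L a) ^ n) < 1 := by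
        intro s
        induction s using Finset.induction with
        | empty => simp [hN0]
        | insert n s hn ih =>
          rw [Finset.sum_insert hn]
          refine lt_of_le_of_lt (hadd _ _) (max_lt ?_ ih)
          rw [hmul, hF, norm_neg]
          have : N (algebraMap K L a ^ n) ≤ 1 := by
            induction n with
            | zero => simp [hN1]
            | succ n ih2 =>
              have hp : ∀ m : ℕ, N (algebraMap K L a ^ m) ≤ 1 := by
                intro m
                induction m with
                | zero => simp [hN1]
                | succ m ih3 =>
                  rw [pow_succ, hmul]
                  exact mul_le_one₀ ih3 (hnn _) ha
              exact hp _
          have := hr n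
          nlinarith [hnn (algebraMap K L a ^ n), norm_nonneg (P.coeff n - ρ (r n))]
      exact hsum _
lemma laurent_fr_of_no_i {K : Type*} [Field K] [Algebra (LaurentSeries ℝ) K]
    [FiniteDimensional (LaurentSeries ℝ) K]
    (hi : ∀ a : K, a ^ 2 ≠ -1) : IsFormallyReal K := by
  have : (Valued.v : Valuation (LaurentSeries ℝ) (WithZero (Multiplicative ℤ))).IsRankOneDiscrete := by
    rw [LaurentSeries.valuation_def]; infer_instance
  let hr1 : Valuation.RankOne (Valued.v : Valuation (LaurentSeries ℝ) (WithZero (Multiplicative ℤ))) :=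
    Valuation.IsRankOneDiscrete.rankOne _ (e := 2) (by norm_num)
  let := Valued.toNontriviallyNormedField (L := LaurentSeries ℝ) (Γ₀ := WithZero (Multiplicative ℤ))
  have hexp : WithZero.exp (-(0 : ℤ)) = (1 : WithZero (Multiplicative ℤ)) := by simp
  have hexp1 : WithZero.exp (-(1 : ℤ)) < (1 : WithZero (Multiplicative ℤ)) := by
    rw [← hexp, WithZero.exp_lt_exp]; norm_num
  have hC : ∀ r : ℝ, Valued.v (HahnSeries.C r : LaurentSeries ℝ) ≤ (1 : WithZero (Multiplicative ℤ)) := by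
    intro r
    rw [← hexp, LaurentSeries.valuation_le_iff_coeff_lt_eq_zero]
    intro n hn
    simp [HahnSeries.C_apply, HahnSeries.coeff_single_of_ne hn.ne]
  have hres0 : ∀ f : LaurentSeries ℝ, Valued.v f ≤ (1 : WithZero (Multiplicative ℤ)) → ∃ r : ℝ,
      Valued.v (f - HahnSeries.C r) < (1 : WithZero (Multiplicative ℤ)) := by
    intro f hf
    refine ⟨f.coeff 0, lt_of_le_of_lt ?_ hexp1⟩
    rw [← hexp, LaurentSeries.valuation_le_iff_coeff_lt_eq_zero] at hf
    rw [LaurentSeries.valuation_le_iff_coeff_lt_eq_zero]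
    intro n hn
    rcases eq_or_ne n 0 with rfl | h
    · simp [HahnSeries.C_apply]
    · have : n < 0 := by omega
      simp [HahnSeries.C_apply, HahnSeries.coeff_single_of_ne h, hf n this]
  apply fr_of_no_i (F := LaurentSeries ℝ) (K := K) HahnSeries.C ?_ ?_ hi
  · intro r hr
    have h1 := Valued.toNormedField.norm_le_one_iff.mpr (hC r)
    have h2 := Valued.toNormedField.norm_le_one_iff.mpr (hC r⁻¹)
    rw [map_inv₀, norm_inv] at h2
    have h3 : 0 < ‖(HahnSeries.C r : LaurentSeries ℝ)‖ := by
      rw [norm_pos_iff]; simpa using hr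
    exact le_antisymm h1 ((inv_le_one₀ h3).mp h2)
  · intro a ha
    obtain ⟨r, hr⟩ := hres0 a (Valued.toNormedField.norm_le_one_iff.mp ha)
    exact ⟨r, Valued.toNormedField.norm_lt_one_iff.mpr hr⟩

structure PreOrd {F : Type*} [Field F] (S : Set F) : Prop where
  sq : ∀ a, a * a ∈ S
  add : ∀ a ∈ S, ∀ b ∈ S, a + b ∈ S
  mul : ∀ a ∈ S, ∀ b ∈ S, a * b ∈ S
  neg : (-1 : F) ∉ S

lemma PreOrd.extend {F : Type*} [Field F] {S : Set F} (h : PreOrd S) (c : F)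
    (hc : -c ∉ S) : PreOrd {x : F | ∃ a ∈ S, ∃ b ∈ S, x = a + c * b} where
  sq a := ⟨a * a, h.sq a, 0, by simpa using h.sq 0, by ring⟩
  add := by
    rintro _ ⟨a, ha, b, hb, rfl⟩ _ ⟨a', ha', b', hb', rfl⟩
    exact ⟨a + a', h.add _ ha _ ha', b + b', h.add _ hb _ hb', by ring⟩
  mul := by
    rintro _ ⟨a, ha, b, hb, rfl⟩ _ ⟨a', ha', b', hb', rfl⟩
    exact ⟨a * a' + (c * c) * (b * b'),
      h.add _ (h.mul _ ha _ ha') _ (h.mul _ (h.sq c) _ (h.mul _ hb _ hb')),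
      a * b' + a' * b, h.add _ (h.mul _ ha _ hb') _ (h.mul _ ha' _ hb), by ring⟩
  neg := by
    rintro ⟨a, ha, b, hb, e⟩
    have hb0 : b ≠ 0 := by
      rintro rfl
      apply h.neg
      rw [e]; simpa using ha
    apply hc
    have : -c = (1 * 1 + a) * b * (b⁻¹ * b⁻¹) := by
      have : 1 * 1 + a = - (c * b) := by linear_combination -e
      rw [this]; field_simp
    rw [this]
    exact h.mul _ (h.mul _ (h.add _ (h.sq 1) _ ha) _ hb) _ (h.sq _)

lemma artin {F : Type*} [Field F] [CharZero F] (f : F)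
    (hf : ∀ P : Set F, IsOrderingF P → f ∈ P) : IsSumSq f := by
  by_contra hcon
  have hT : PreOrd {x : F | IsSumSq x} := by
    refine ⟨fun a => IsSumSq.mul_self a, fun a ha b hb => IsSumSq.add ha hb,
      fun a ha b hb => IsSumSq.mul ha hb, fun hneg => hcon ?_⟩
    have : f = ((f + 1) / 2) * ((f + 1) / 2) + (-1) * (((f - 1) / 2) * ((f - 1) / 2)) := by ring
    rw [this]
    exact IsSumSq.add (IsSumSq.mul_self _) (IsSumSq.mul hneg (IsSumSq.mul_self _))
  have hT' := hT.extend (-f) (by simpa using hcon)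
  obtain ⟨P, hsub, hmax⟩ := zorn_subset_nonempty {S : Set F | PreOrd S} (by
    intro c hc hchain hne
    refine ⟨⋃₀ c, ?_, fun s hs => Set.subset_sUnion_of_mem hs⟩
    obtain ⟨s0, hs0⟩ := hne
    refine ⟨fun a => ⟨s0, hs0, (hc hs0).sq a⟩, ?_, ?_, ?_⟩
    · rintro a ⟨s, hs, ha⟩ b ⟨t, ht, hb⟩
      rcases hchain.total hs ht with h | h
      · exact ⟨t, ht, (hc ht).add _ (h ha) _ hb⟩
      · exact ⟨s, hs, (hc hs).add _ ha _ (h hb)⟩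
    · rintro a ⟨s, hs, ha⟩ b ⟨t, ht, hb⟩
      rcases hchain.total hs ht with h | h
      · exact ⟨t, ht, (hc ht).mul _ (h ha) _ hb⟩
      · exact ⟨s, hs, (hc hs).mul _ ha _ (h hb)⟩
    · rintro ⟨s, hs, ha⟩
      exact (hc hs).neg ha) _ hT'
  have hP : PreOrd P := hmax.1
  have h1 : (1 : F) ∈ P := by simpa using hP.sq 1
  have h0 : (0 : F) ∈ P := by simpa using hP.sq 0
  have hsupp : ∀ a : F, a ∈ P → -a ∈ P → a = 0 := by
    intro a ha hna
    by_contra h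
    apply hP.neg
    have : (-1 : F) = a * (-a) * (a⁻¹ * a⁻¹) := by field_simp
    rw [this]
    exact hP.mul _ (hP.mul _ ha _ hna) _ (hP.sq _)
  have hord : IsOrderingF P := by
    refine ⟨hP.add, hP.mul, ?_, hsupp⟩
    intro a
    by_contra h
    push Not at h
    have h2 := hP.extend a h.2
    have h3 := hmax.2 h2 (fun x hx => ⟨x, hx, 0, h0, by ring⟩)
    exact h.1 (h3 ⟨0, h0, 1, h1, by ring⟩)
  have hnf : -f ∈ P := hsub ⟨0, IsSumSq.zero, 1, IsSumSq.one, by ring⟩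
  have := hsupp f (hf P hord) hnf
  rw [this] at hcon
  exact hcon IsSumSq.zero

lemma IsSumSq.map_hom {A B : Type*} [CommRing A] [CommRing B] (φ : A →+* B) {s : A}
    (hs : IsSumSq s) : IsSumSq (φ s) := by
  induction hs with
  | zero => rw [map_zero]; exact IsSumSq.zero
  | sq_add a hs ih => rw [map_add, map_mul]; exact IsSumSq.sq_add _ ih

/-- a real prime element -/
structure RealPrime {A : Type*} [CommRing A] (p : A) : Prop where
  prime : Prime p
  real : ∀ a s, IsSumSq s → p ∣ a * a + s → p ∣ a

lemma RealPrime.of_hom {A B : Type*} [CommRing A] [CommRing B] [IsDomain B] [IsFormallyReal B]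
    (φ : A →+* B) {p : A} (hp0 : p ≠ 0) (h : ∀ a, φ a = 0 ↔ p ∣ a) : RealPrime p := by
  refine ⟨⟨hp0, ?_, ?_⟩, ?_⟩
  · intro hu
    have := (h 1).mpr hu.dvd
    simp at this
  · intro a b hab
    rw [← h, map_mul] at hab
    rw [← h, ← h]
    exact mul_eq_zero.mp hab
  · intro a s hs hd
    rw [← h] at hd ⊢
    rw [map_add, map_mul] at hd
    exact mul_self_eq_zero.mp
      (IsFormallyReal.eq_zero_of_add_right (IsSumSq.mul_self _) (hs.map_hom φ) hd)

lemma RealPrime.sumSq {A : Type*} [CommRing A] {p : A} (hp : RealPrime p) {s : A}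
    (hs : IsSumSq s) (hd : p ∣ s) : ∃ t, IsSumSq t ∧ s = p ^ 2 * t := by
  induction hs with
  | zero => exact ⟨0, IsSumSq.zero, by ring⟩
  | @sq_add a s hs ih =>
    obtain ⟨b, rfl⟩ := hp.real a s hs hd
    have : p ∣ s := by
      have := dvd_sub hd (show p ∣ p * b * (p * b) from ⟨b * (p * b), by ring⟩)
      simpa using this
    obtain ⟨t, ht, rfl⟩ := ih this
    exact ⟨b * b + t, IsSumSq.sq_add b ht, by ring⟩

lemma RealPrime.descend {A : Type*} [CommRing A] [IsDomain A] [WfDvdMonoid A] {p : A}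
    (hp : RealPrime p) {f d : A} (hd : d ≠ 0) (hs : IsSumSq (f * d ^ 2)) (hpf : p ∣ f) :
    ∃ f' d', f = p ^ 2 * f' ∧ d' ≠ 0 ∧ IsSumSq (f' * d' ^ 2) := by
  have hp0 := hp.prime.ne_zero
  obtain ⟨c, hc, hpc⟩ :=
    (FiniteMultiplicity.of_not_isUnit hp.prime.not_isUnit hd).exists_eq_pow_mul_and_not_dvd
  have key : ∀ k : ℕ, IsSumSq (f * (p ^ k * c) ^ 2) → IsSumSq (f * c ^ 2) := by
    intro k
    induction k with
    | zero => simp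
    | succ k ih =>
      intro h
      obtain ⟨t, ht, e⟩ := hp.sumSq h (hpf.mul_right _)
      apply ih
      have : f * (p ^ k * c) ^ 2 = t := by
        apply mul_left_cancel₀ (pow_ne_zero 2 hp0)
        rw [← e]; ring
      rwa [this]
  rw [hc] at hs
  have h1 := key _ hs
  obtain ⟨t, ht, e⟩ := hp.sumSq h1 (hpf.mul_right _)
  obtain ⟨g, rfl⟩ := hpf
  have e2 : g * c ^ 2 = p * t := by
    apply mul_left_cancel₀ hp0; linear_combination e
  have : p ∣ g := by
    rcases hp.prime.dvd_or_dvd (Dvd.intro _ e2.symm) with h | h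
    · exact h
    · exact absurd (hp.prime.dvd_of_dvd_pow h) hpc
  obtain ⟨f', rfl⟩ := this
  refine ⟨f', c, by ring, ?_, ?_⟩
  · rintro rfl
    exact hpc (dvd_zero _)
  · have : f' * c ^ 2 = t := by
      apply mul_left_cancel₀ hp0; linear_combination e2
    rwa [this]

lemma main_induction {A : Type*} [CommRing A] [IsDomain A] [WfDvdMonoid A]
    (h1 : ∀ u d : A, IsUnit u → d ≠ 0 → IsSumSq (u * d ^ 2) → ∃ g h, u = g ^ 2 + h ^ 2)
    (h2 : ∀ f : A, f ≠ 0 → ¬ IsUnit f →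
      ∃ p, p ∣ f ∧ ¬ IsUnit p ∧ (RealPrime p ∨ ∃ a b, p = a ^ 2 + b ^ 2)) (f : A) :
    ∀ d, d ≠ 0 → IsSumSq (f * d ^ 2) → ∃ g h, f = g ^ 2 + h ^ 2 := by
  refine WellFounded.induction (C := fun f : A => ∀ d, d ≠ 0 → IsSumSq (f * d ^ 2) →
    ∃ g h, f = g ^ 2 + h ^ 2) (IsWellFounded.wf (r := DvdNotUnit (α := A))) f ?_
  intro f ih
  intro d hd hs
  by_cases hf0 : f = 0
  · exact ⟨0, 0, by simp [hf0]⟩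
  by_cases hfu : IsUnit f
  · exact h1 f d hfu hd hs
  obtain ⟨p, hpf, hpu, hp | ⟨a, b, hp⟩⟩ := h2 f hf0 hfu
  · obtain ⟨f', d', e, hd', hs'⟩ := hp.descend hd hs hpf
    have hfz : f' ≠ 0 := by rintro rfl; simp [e] at hf0
    obtain ⟨g, h, e'⟩ := ih f' ⟨hfz, p ^ 2, by simpa using hpu, by rw [e]; ring⟩ d' hd' hs'
    exact ⟨p * g, p * h, by rw [e, e']; ring⟩
  · obtain ⟨f', e⟩ := hpf
    have hfz : f' ≠ 0 := by rintro rfl; simp [e] at hf0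
    have hp0 : p ≠ 0 := by rintro rfl; simp [e] at hf0
    have hs' : IsSumSq (f' * (p * d) ^ 2) := by
      have : f' * (p * d) ^ 2 = (a * a + b * b) * (f * d ^ 2) := by rw [e, hp]; ring
      rw [this]
      exact IsSumSq.mul (IsSumSq.add (IsSumSq.mul_self _) (IsSumSq.mul_self _)) hs
    obtain ⟨g, h, e'⟩ := ih f' ⟨hfz, p, hpu, by rw [e]; ring⟩ (p * d) (mul_ne_zero hp0 hd) hs'
    exact ⟨a * g - b * h, a * h + b * g, by rw [e, e', hp]; ring⟩

lemma realPrime_X {R : Type*} [CommRing R] [IsDomain R] [IsFormallyReal R] :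
    RealPrime (PowerSeries.X : PowerSeries R) :=
  RealPrime.of_hom (PowerSeries.constantCoeff (R := R)) PowerSeries.X_ne_zero
    (fun _ => PowerSeries.X_dvd_iff.symm)

lemma fr_powerSeries {R : Type*} [CommRing R] [IsDomain R] [IsFormallyReal R] :
    IsFormallyReal (PowerSeries R) := by
  have key : ∀ n : ℕ, ∀ a s : PowerSeries R, IsSumSq s → a * a + s = 0 →
      PowerSeries.X ^ n ∣ a := by
    intro n
    induction n with
    | zero => intro a s _ _; simp
    | succ n ih =>
      intro a s hs h
      obtain ⟨b, rfl⟩ := realPrime_X.real a s hs (h ▸ dvd_zero _)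
      have hd : (PowerSeries.X : PowerSeries R) ∣ s := by
        refine ⟨-(PowerSeries.X * b * b), ?_⟩
        linear_combination h
      obtain ⟨t, ht, rfl⟩ := realPrime_X.sumSq hs hd
      have h2 : b * b + t = 0 := by
        apply mul_left_cancel₀ (pow_ne_zero 2 (PowerSeries.X_ne_zero (R := R)))
        linear_combination h
      rw [pow_succ']
      exact mul_dvd_mul_left _ (ih b t ht h2)
  refine IsFormallyReal.of_eq_zero_of_eq_zero_of_mul_self_add ?_
  intro s a hs h
  ext n
  exact PowerSeries.X_pow_dvd_iff.mp (key (n + 1) a s hs h) n (Nat.lt_succ_self n)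

lemma fr_of_injective {A B : Type*} [CommRing A] [CommRing B] [IsDomain B] [IsFormallyReal B]
    (φ : A →+* B) (hφ : Function.Injective φ) : IsFormallyReal A := by
  refine IsFormallyReal.of_eq_zero_of_eq_zero_of_mul_self_add ?_
  intro s a hs h
  apply hφ
  rw [map_zero]
  refine mul_self_eq_zero.mp
    (IsFormallyReal.eq_zero_of_add_right (IsSumSq.mul_self _) (hs.map_hom φ) ?_)
  rw [← map_mul, ← map_add, h, map_zero]

lemma fr_laurent : IsFormallyReal (LaurentSeries ℝ) := by
  apply laurent_fr_of_no_i
  intro a h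
  have h1 := congrArg HahnSeries.leadingCoeff h
  rw [pow_two, HahnSeries.leadingCoeff_mul, HahnSeries.leadingCoeff_neg,
    HahnSeries.leadingCoeff_one] at h1
  nlinarith [mul_self_nonneg a.leadingCoeff]

lemma square_of_constantCoeff {R : Type*} [CommRing R] (h2 : IsUnit (2 : R)) (u : PowerSeries R)
    (v : R) (hv : IsUnit v) (huv : PowerSeries.constantCoeff u = v ^ 2) :
    ∃ g, u = g ^ 2 := by
  obtain ⟨g, hg, -⟩ := HenselianRing.is_henselian (I := Ideal.span {(PowerSeries.X : PowerSeries R)})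
    (Polynomial.X ^ 2 - Polynomial.C u) (Polynomial.monic_X_pow_sub_C u two_ne_zero)
    (PowerSeries.C v) (by
      rw [Ideal.mem_span_singleton, PowerSeries.X_dvd_iff]
      simp [huv]) (by
      apply IsUnit.map
      have e : (Polynomial.X ^ 2 - Polynomial.C u).derivative.eval (PowerSeries.C v)
          = PowerSeries.C (2 * v) := by
        rw [map_mul, map_ofNat]
        simp [one_add_one_eq_two]
      rw [e]
      exact (h2.mul hv).map _)
  exact ⟨g, by simpa [sub_eq_zero, eq_comm] using hg⟩

lemma pos_square (u : PowerSeries (PowerSeries ℝ))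
    (h : 0 < PowerSeries.constantCoeff (PowerSeries.constantCoeff u)) : ∃ g, u = g ^ 2 := by
  have h2 : IsUnit (2 : ℝ) := by simp
  have h2' : IsUnit (2 : PowerSeries ℝ) := by
    rw [← map_ofNat (PowerSeries.C (R := ℝ)) 2]; exact h2.map _
  obtain ⟨v, hv⟩ := square_of_constantCoeff h2 (PowerSeries.constantCoeff u) (Real.sqrt _)
    (Real.sqrt_pos.mpr h).ne'.isUnit (Real.sq_sqrt h.le).symm
  refine square_of_constantCoeff h2' u v ?_ hv
  rw [PowerSeries.isUnit_iff_constantCoeff, isUnit_iff_ne_zero]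
  intro h0
  rw [hv] at h
  simp [h0] at h

lemma unit_case (u d : PowerSeries (PowerSeries ℝ)) (hu : IsUnit u) (hd : d ≠ 0)
    (hs : IsSumSq (u * d ^ 2)) : ∃ g h, u = g ^ 2 + h ^ 2 := by
  rw [PowerSeries.isUnit_iff_constantCoeff, PowerSeries.isUnit_iff_constantCoeff,
    isUnit_iff_ne_zero] at hu
  rcases lt_or_gt_of_ne hu with h | h
  · exfalso
    obtain ⟨g, hg⟩ := pos_square (-u) (by simpa using h)
    have : IsFormallyReal (PowerSeries ℝ) := fr_powerSeries
    have : IsFormallyReal (PowerSeries (PowerSeries ℝ)) := fr_powerSeries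
    have h1 := IsFormallyReal.eq_zero_of_add_right (IsSumSq.mul_self (g * d)) hs (by
      linear_combination (-d ^ 2) * hg)
    rcases mul_eq_zero.mp (mul_self_eq_zero.mp h1) with h | h
    · rw [h] at hg
      have : u = 0 := by simpa using hg
      simp [this] at hu
    · exact hd h
  · obtain ⟨g, hg⟩ := pos_square u h
    exact ⟨g, 0, by simp [hg]⟩

lemma fr_polynomial {R : Type*} [CommRing R] [IsDomain R] [IsFormallyReal R] :
    IsFormallyReal (Polynomial R) := by
  have : IsFormallyReal (PowerSeries R) := fr_powerSeries
  exact fr_of_injective (Polynomial.coeToPowerSeries.ringHom (R := R)) (Polynomial.coe_injective R)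

lemma thue_s10 {F : Type*} [Field F] [IsFormallyReal F] (p : Polynomial F) (hp : p.Monic)
    (i : AdjoinRoot p) (hi : i ^ 2 = -1) : ∃ a b : Polynomial F, p = a ^ 2 + b ^ 2 := by
  have hFX : IsFormallyReal (Polynomial F) := fr_polynomial
  set n := p.natDegree with hn
  let pb := AdjoinRoot.powerBasis hp.ne_zero
  have hfin : FiniteDimensional F (AdjoinRoot p) := pb.finite
  have hrank : Module.finrank F (AdjoinRoot p) = n := by
    rw [pb.finrank, AdjoinRoot.powerBasis_dim]
  let D := Polynomial.degreeLT F (n / 2 + 1)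
  have hD : Module.finrank F D = n / 2 + 1 := by
    rw [(Polynomial.degreeLTEquiv F (n / 2 + 1)).finrank_eq]; simp
  have : FiniteDimensional F D :=
    Module.Finite.equiv (Polynomial.degreeLTEquiv F (n / 2 + 1)).symm
  let M : Polynomial F →ₗ[F] AdjoinRoot p := (AdjoinRoot.mkₐ p).toLinearMap
  let L : (D × D) →ₗ[F] AdjoinRoot p :=
    (M ∘ₗ D.subtype).coprod (-(LinearMap.mulLeft F i ∘ₗ M ∘ₗ D.subtype))
  have hker := LinearMap.ker_ne_bot_of_finrank_lt (f := L) (by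
    rw [Module.finrank_prod, hD, hrank]; omega)
  obtain ⟨⟨⟨a, ha⟩, ⟨b, hb⟩⟩, hab, hne⟩ := (Submodule.ne_bot_iff _).mp hker
  have e1 : AdjoinRoot.mk p a = i * AdjoinRoot.mk p b := by
    have : AdjoinRoot.mk p a + -(i * AdjoinRoot.mk p b) = 0 := by
      simpa [L, M] using hab
    linear_combination this
  have hdvd : p ∣ a * a + b * b := by
    rw [← AdjoinRoot.mk_eq_zero, map_add, map_mul, map_mul, e1]
    linear_combination (AdjoinRoot.mk p b) ^ 2 * hi
  have hsum : a * a + b * b ≠ 0 := by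
    intro h0
    have ha0 : a = 0 := mul_self_eq_zero.mp
      (IsFormallyReal.eq_zero_of_add_right (IsSumSq.mul_self _) (IsSumSq.mul_self _) h0)
    have hb0 : b = 0 := mul_self_eq_zero.mp
      (IsFormallyReal.eq_zero_of_add_left (IsSumSq.mul_self _) (IsSumSq.mul_self _) h0)
    subst ha0 hb0
    exact hne rfl
  have hda : a.natDegree ≤ n / 2 := by
    rw [Polynomial.mem_degreeLT] at ha
    by_cases h0 : a = 0
    · simp [h0]
    · exact Nat.le_of_lt_succ ((Polynomial.natDegree_lt_iff_degree_lt h0).mpr ha)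
  have hdb : b.natDegree ≤ n / 2 := by
    rw [Polynomial.mem_degreeLT] at hb
    by_cases h0 : b = 0
    · simp [h0]
    · exact Nat.le_of_lt_succ ((Polynomial.natDegree_lt_iff_degree_lt h0).mpr hb)
  have hdeg : (a * a + b * b).natDegree ≤ n / 2 + n / 2 :=
    (Polynomial.natDegree_add_le_of_degree_le
      (Polynomial.natDegree_mul_le_of_le hda hda) (Polynomial.natDegree_mul_le_of_le hdb hdb))
  obtain ⟨q, hq⟩ := hdvd
  have hq0 : q ≠ 0 := by rintro rfl; exact hsum (by rw [hq, mul_zero])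
  have hdq : n + q.natDegree = (a * a + b * b).natDegree := by
    rw [hq, hp.natDegree_mul' hq0]
  have hq1 : q.natDegree = 0 := by omega
  obtain ⟨c, rfl⟩ := Polynomial.natDegree_eq_zero.mp hq1
  have hc0 : c ≠ 0 := by rintro rfl; simp at hq0
  have hn2 : n = n / 2 + n / 2 := by omega
  have hc : c = a.coeff (n / 2) * a.coeff (n / 2) + b.coeff (n / 2) * b.coeff (n / 2) := by
    have := congrArg (fun r => Polynomial.coeff r (n / 2 + n / 2)) hq
    simp only [Polynomial.coeff_add, Polynomial.coeff_mul_add_eq_of_natDegree_le hda hda,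
      Polynomial.coeff_mul_add_eq_of_natDegree_le hdb hdb, Polynomial.coeff_mul_C] at this
    rw [this, ← hn2, hn, hp.coeff_natDegree, one_mul]
  set α := a.coeff (n / 2)
  set β := b.coeff (n / 2)
  have hC : (Polynomial.C c : Polynomial F) = Polynomial.C α * Polynomial.C α + Polynomial.C β * Polynomial.C β := by
    rw [hc]; simp
  have hinv : Polynomial.C c * Polynomial.C c⁻¹ = (1 : Polynomial F) := by
    rw [← Polynomial.C_mul, mul_inv_cancel₀ hc0, Polynomial.C_1]
  refine ⟨Polynomial.C c⁻¹ * (a * Polynomial.C α - b * Polynomial.C β),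
    Polynomial.C c⁻¹ * (a * Polynomial.C β + b * Polynomial.C α), ?_⟩
  have : (Polynomial.C c⁻¹ * (a * Polynomial.C α - b * Polynomial.C β)) ^ 2 +
    (Polynomial.C c⁻¹ * (a * Polynomial.C β + b * Polynomial.C α)) ^ 2 =
     Polynomial.C c⁻¹ ^ 2 * ((a * a + b * b) * (Polynomial.C α * Polynomial.C α + Polynomial.C β * Polynomial.C β)) := by ring
  rw [this, ← hC, hq]
  have : Polynomial.C c⁻¹ ^ 2 * (p * Polynomial.C c * Polynomial.C c) =
    p * (Polynomial.C c * Polynomial.C c⁻¹) ^ 2 := by ring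
  rw [this, hinv]; ring

lemma RealPrime.two_squares {A : Type*} [CommRing A] [IsDomain A] {π : A} (hπ : RealPrime π) (p : A) :
    ∀ (k : ℕ) (a b : A), (π ^ k) ^ 2 * p = a ^ 2 + b ^ 2 → ∃ a b, p = a ^ 2 + b ^ 2 := by
  intro k
  induction k with
  | zero => intro a b h; exact ⟨a, b, by simpa using h⟩
  | succ k ih =>
    intro a b h
    have h1 : π ∣ a * a + b * b := ⟨π * (π ^ k) ^ 2 * p, by linear_combination -h⟩
    obtain ⟨a', rfl⟩ := hπ.real a (b * b) (IsSumSq.mul_self _) h1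
    obtain ⟨b', rfl⟩ := hπ.real b (π * a' * (π * a')) (IsSumSq.mul_self _) (by rwa [add_comm])
    refine ih a' b' ?_
    apply mul_left_cancel₀ (pow_ne_zero 2 hπ.prime.ne_zero)
    linear_combination h

lemma realPrime_CX : RealPrime (Polynomial.C (PowerSeries.X : PowerSeries ℝ)) := by
  have : IsFormallyReal (Polynomial ℝ) := fr_polynomial
  refine RealPrime.of_hom (Polynomial.mapRingHom (PowerSeries.constantCoeff (R := ℝ)))
    (by simp) ?_
  intro a
  rw [Polynomial.C_dvd_iff_dvd_coeff]
  simp [Polynomial.ext_iff, PowerSeries.X_dvd_iff]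

lemma descend_two_squares (p : Polynomial (PowerSeries ℝ)) (a b : Polynomial (LaurentSeries ℝ))
    (h : p.map (algebraMap (PowerSeries ℝ) (LaurentSeries ℝ)) = a ^ 2 + b ^ 2) :
    ∃ a b : Polynomial (PowerSeries ℝ), p = a ^ 2 + b ^ 2 := by
  have hinj : Function.Injective (algebraMap (PowerSeries ℝ) (LaurentSeries ℝ)) :=
    IsFractionRing.injective _ _
  obtain ⟨d, hd, hda⟩ := IsLocalization.integerNormalization_spec (nonZeroDivisors (PowerSeries ℝ)) a
  obtain ⟨e, he, heb⟩ := IsLocalization.integerNormalization_spec (nonZeroDivisors (PowerSeries ℝ)) b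
  set a' := IsLocalization.integerNormalization (nonZeroDivisors (PowerSeries ℝ)) a
  set b' := IsLocalization.integerNormalization (nonZeroDivisors (PowerSeries ℝ)) b
  have hde : d * e ≠ 0 := mul_ne_zero (nonZeroDivisors.ne_zero hd) (nonZeroDivisors.ne_zero he)
  have hX : Prime (PowerSeries.X : PowerSeries ℝ) := PowerSeries.X_prime
  obtain ⟨u, hu, hXu⟩ :=
    (FiniteMultiplicity.of_not_isUnit hX.not_isUnit hde).exists_eq_pow_mul_and_not_dvd
  have huu : IsUnit u := by
    rw [PowerSeries.isUnit_iff_constantCoeff, isUnit_iff_ne_zero]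
    rwa [PowerSeries.X_dvd_iff] at hXu
  obtain ⟨v, hv⟩ := huu.exists_right_inv
  set k := multiplicity PowerSeries.X (d * e)
  refine realPrime_CX.two_squares p k (Polynomial.C (v * e) * a') (Polynomial.C (v * d) * b') ?_
  apply Polynomial.map_injective _ hinj
  have hk : (PowerSeries.X ^ k : PowerSeries ℝ) = v * (d * e) := by
    rw [hu]; linear_combination (-PowerSeries.X ^ k) * hv
  rw [← Polynomial.C_pow, hk]
  have hsm : ∀ (r : PowerSeries ℝ) (q : Polynomial (LaurentSeries ℝ)),
      r • q = Polynomial.C (algebraMap (PowerSeries ℝ) (LaurentSeries ℝ) r) * q := by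
    intro r q
    rw [← Polynomial.smul_eq_C_mul, algebraMap_smul]
  rw [hsm] at hda heb
  simp only [Polynomial.map_mul, Polynomial.map_add, Polynomial.map_pow, Polynomial.map_C, hda,
    heb, h, map_mul]
  ring

lemma CX_dvd_iff (f : PowerSeries (PowerSeries ℝ)) :
    PowerSeries.map (PowerSeries.constantCoeff (R := ℝ)) f = 0 ↔
      PowerSeries.C (PowerSeries.X : PowerSeries ℝ) ∣ f := by
  constructor
  · intro h
    have : ∀ n, ∃ g, PowerSeries.coeff n f = PowerSeries.X * g := by
      intro n
      have h1 := congrArg (PowerSeries.coeff n) h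
      rw [PowerSeries.coeff_map, map_zero, ← PowerSeries.X_dvd_iff] at h1
      exact h1
    choose g hg using this
    refine ⟨PowerSeries.mk g, ?_⟩
    ext1 n
    rw [PowerSeries.coeff_C_mul, PowerSeries.coeff_mk, hg]
  · rintro ⟨g, rfl⟩
    simp

instance isAdicComplete_max :
    IsAdicComplete (IsLocalRing.maximalIdeal (PowerSeries ℝ)) (PowerSeries ℝ) := by
  rw [PowerSeries.maximalIdeal_eq_span_X]; infer_instance

lemma distinguished_factor {W p : Polynomial (PowerSeries ℝ)}
    (hW : W.IsDistinguishedAt (IsLocalRing.maximalIdeal (PowerSeries ℝ))) (hp : p.Monic)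
    (hd : p ∣ W) : p.IsDistinguishedAt (IsLocalRing.maximalIdeal (PowerSeries ℝ)) := by
  have h1 := Polynomial.map_dvd (Ideal.Quotient.mk (IsLocalRing.maximalIdeal (PowerSeries ℝ))) hd
  rw [hW.map_eq_X_pow] at h1
  obtain ⟨j, -, hj⟩ := (dvd_prime_pow Polynomial.prime_X _).mp h1
  have h2 := Polynomial.eq_of_monic_of_associated (hp.map _) (Polynomial.monic_X_pow j) hj
  have h3 : p.natDegree = j := by
    rw [← hp.natDegree_map (Ideal.Quotient.mk (IsLocalRing.maximalIdeal (PowerSeries ℝ))), h2,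
      Polynomial.natDegree_X_pow]
  refine ⟨⟨?_⟩, hp⟩
  intro n hn
  have h4 := congrArg (fun q => Polynomial.coeff q n) h2
  simp only [Polynomial.coeff_map, Polynomial.coeff_X_pow] at h4
  rw [if_neg (by omega), Ideal.Quotient.eq_zero_iff_mem] at h4
  exact h4

/-- The ring isomorphism underlying the Weierstrass isomorphism of quotients. -/
def weierstrassEquiv {R : Type*} [CommRing R] {I : Ideal R} [IsAdicComplete I R]
    {p : Polynomial R} (hp : p.IsDistinguishedAt I) :
    (Polynomial R ⧸ Ideal.span {p}) ≃+* (PowerSeries R ⧸ Ideal.span {(p : PowerSeries R)}) :=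
  hp.algEquivQuotient.toRingEquiv

lemma realPrime_of_distinguished {p : Polynomial (PowerSeries ℝ)}
    (hp : p.IsDistinguishedAt (IsLocalRing.maximalIdeal (PowerSeries ℝ)))
    {K : Type*} [CommRing K] [IsDomain K] [IsFormallyReal K] (ψ : Polynomial (PowerSeries ℝ) →+* K)
    (hψ : ∀ q, ψ q = 0 ↔ p ∣ q) : RealPrime (p : PowerSeries (PowerSeries ℝ)) := by
  let φ : (Polynomial (PowerSeries ℝ) ⧸ Ideal.span {p}) →+* K :=
    Ideal.Quotient.lift _ ψ (fun q hq => (hψ q).mpr (Ideal.mem_span_singleton.mp hq))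
  have hφ : Function.Injective φ := by
    rw [injective_iff_map_eq_zero]
    intro a ha
    obtain ⟨q, rfl⟩ := Ideal.Quotient.mk_surjective a
    rw [Ideal.Quotient.eq_zero_iff_mem, Ideal.mem_span_singleton, ← hψ]
    simpa [φ] using ha
  let e := (weierstrassEquiv hp).symm
  refine RealPrime.of_hom ((φ.comp e.toRingHom).comp (Ideal.Quotient.mk (Ideal.span {(p : PowerSeries (PowerSeries ℝ))}))) ?_ ?_
  · simpa using hp.monic.ne_zero
  · intro a
    rw [← Ideal.mem_span_singleton, ← Ideal.Quotient.eq_zero_iff_mem]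
    simp only [RingHom.comp_apply]
    rw [map_eq_zero_iff φ hφ]
    exact map_eq_zero_iff e e.injective

lemma factor_case (f : PowerSeries (PowerSeries ℝ)) (hfu : ¬ IsUnit f) :
    ∃ p, p ∣ f ∧ ¬ IsUnit p ∧ (RealPrime p ∨ ∃ a b, p = a ^ 2 + b ^ 2) := by
  have hR : IsFormallyReal (PowerSeries ℝ) := fr_powerSeries
  have hL : IsFormallyReal (LaurentSeries ℝ) := fr_laurent
  by_cases hX : PowerSeries.C (PowerSeries.X : PowerSeries ℝ) ∣ f
  · have hr : RealPrime (PowerSeries.C (PowerSeries.X : PowerSeries ℝ)) :=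
      RealPrime.of_hom (PowerSeries.map (PowerSeries.constantCoeff (R := ℝ)))
        ((map_ne_zero_iff _ PowerSeries.C_injective).mpr PowerSeries.X_ne_zero) CX_dvd_iff
    exact ⟨_, hX, hr.prime.not_isUnit, Or.inl hr⟩
  have hres : f.map (IsLocalRing.residue (PowerSeries ℝ)) ≠ 0 := by
    intro h
    apply hX
    rw [← CX_dvd_iff]
    ext1 n
    have h1 := congrArg (PowerSeries.coeff n) h
    rw [PowerSeries.coeff_map, map_zero, IsLocalRing.residue_eq_zero_iff,
      PowerSeries.maximalIdeal_eq_span_X, Ideal.mem_span_singleton, PowerSeries.X_dvd_iff] at h1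
    rw [PowerSeries.coeff_map, h1, map_zero]
  obtain ⟨W, h, hWh⟩ := PowerSeries.exists_isWeierstrassFactorization hres
  have hW := hWh.isDistinguishedAt
  have hWu : ¬ IsUnit W := by
    intro hu
    apply hfu
    rw [hWh.eq_mul]
    exact (hu.map (Polynomial.coeToPowerSeries.ringHom (R := PowerSeries ℝ))).mul hWh.isUnit
  obtain ⟨q, hq, r, hqr⟩ := WfDvdMonoid.exists_irreducible_factor hWu hW.monic.ne_zero
  have hlead : IsUnit q.leadingCoeff := by
    have h1 := hW.monic.leadingCoeff
    rw [hqr, Polynomial.leadingCoeff_mul] at h1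
    exact IsUnit.of_mul_eq_one _ h1
  obtain ⟨v, hv⟩ := hlead.exists_right_inv
  have hvu : IsUnit v := IsUnit.of_mul_eq_one_right _ hv
  set p := Polynomial.C v * q with hpdef
  have hass : Associated q p := by
    rw [hpdef, mul_comm]
    exact (associated_mul_unit_right q _ (hvu.map Polynomial.C))
  have hp : p.Monic := by
    rw [Polynomial.Monic, hpdef, Polynomial.leadingCoeff_mul, Polynomial.leadingCoeff_C, mul_comm, hv]
  have hpi : Irreducible p := hass.irreducible hq
  have hpW : p ∣ W := hass.symm.dvd.trans ⟨r, hqr⟩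
  have hpd := distinguished_factor hW hp hpW
  have hdeg : 0 < p.natDegree := by
    rw [Nat.pos_iff_ne_zero]
    intro h0
    exact hpi.not_isUnit (by rw [Polynomial.eq_one_of_monic_natDegree_zero hp h0]; exact isUnit_one)
  have hpf : (p : PowerSeries (PowerSeries ℝ)) ∣ f := by
    rw [hWh.eq_mul]
    exact (map_dvd (Polynomial.coeToPowerSeries.ringHom (R := PowerSeries ℝ)) hpW).mul_right _
  have hpu : ¬ IsUnit (p : PowerSeries (PowerSeries ℝ)) := by
    rw [PowerSeries.isUnit_iff_constantCoeff, Polynomial.constantCoeff_coe]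
    exact hpd.mem hdeg
  refine ⟨p, hpf, hpu, ?_⟩
  let g := algebraMap (PowerSeries ℝ) (LaurentSeries ℝ)
  have hginj : Function.Injective g := IsFractionRing.injective _ _
  have hpF : Irreducible (p.map g) :=
    (Polynomial.Monic.irreducible_iff_irreducible_map_fraction_map hp).mp hpi
  have hpFm : (p.map g).Monic := hp.map g
  by_cases hi : ∃ i : AdjoinRoot (p.map g), i ^ 2 = -1
  · right
    obtain ⟨i, hi⟩ := hi
    obtain ⟨a, b, hab⟩ := thue_s10 _ hpFm i hi
    obtain ⟨a', b', hab'⟩ := descend_two_squares p a b hab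
    refine ⟨(a' : PowerSeries (PowerSeries ℝ)), (b' : PowerSeries (PowerSeries ℝ)), ?_⟩
    rw [← Polynomial.coe_pow, ← Polynomial.coe_pow, ← Polynomial.coe_add, ← hab']
  · left
    push Not at hi
    have : Fact (Irreducible (p.map g)) := ⟨hpF⟩
    have : FiniteDimensional (LaurentSeries ℝ) (AdjoinRoot (p.map g)) :=
      (AdjoinRoot.powerBasis hpFm.ne_zero).finite
    have := laurent_fr_of_no_i (K := AdjoinRoot (p.map g)) hi
    have hdom : IsDomain (AdjoinRoot (p.map g)) := AdjoinRoot.isDomain_of_prime hpF.prime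
    refine realPrime_of_distinguished hpd
      ((AdjoinRoot.mk (p.map g)).comp (Polynomial.mapRingHom g)) ?_
    intro q
    rw [RingHom.comp_apply, AdjoinRoot.mk_eq_zero, Polynomial.coe_mapRingHom,
      Polynomial.map_dvd_map g hginj hp]

/-- `ℝ[[x,y]] ≃ ℝ[[x]][[y]]`. -/
def psEquiv : PS ≃+* PowerSeries (PowerSeries ℝ) :=
  (MvPowerSeries.finSuccEquiv ℝ 1).toRingEquiv.trans
    (RingEquiv.ofRingHom
      (PowerSeries.map ((MvPowerSeries.renameEquiv ℝ (Equiv.ofUnique (Fin 1) Unit)).toRingEquiv :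
        MvPowerSeries (Fin 1) ℝ →+* PowerSeries ℝ))
      (PowerSeries.map ((MvPowerSeries.renameEquiv ℝ (Equiv.ofUnique (Fin 1) Unit)).symm.toRingEquiv :
        PowerSeries ℝ →+* MvPowerSeries (Fin 1) ℝ))
      (by
        ext1 a; ext1 n
        simp only [RingHom.comp_apply, PowerSeries.coeff_map]
        exact AlgEquiv.apply_symm_apply _ _)
      (by
        ext1 a; ext1 n
        simp only [RingHom.comp_apply, PowerSeries.coeff_map]
        exact AlgEquiv.symm_apply_apply _ _))

lemma clear_denominators {A : Type*} [CommRing A] [IsDomain A] (s : FractionRing A)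
    (hs : IsSumSq s) : ∃ d t : A, d ≠ 0 ∧ IsSumSq t ∧
      s * algebraMap A (FractionRing A) d ^ 2 = algebraMap A (FractionRing A) t := by
  induction hs with
  | zero => exact ⟨1, 0, one_ne_zero, IsSumSq.zero, by simp⟩
  | @sq_add a s hs ih =>
    obtain ⟨d, t, hd, ht, e⟩ := ih
    obtain ⟨⟨n, m⟩, hnm⟩ := IsLocalization.surj (nonZeroDivisors A) a
    refine ⟨d * m, (n * d) * (n * d) + (m : A) * m * t,
      mul_ne_zero hd (nonZeroDivisors.ne_zero m.2),
      IsSumSq.sq_add _ (IsSumSq.mul (IsSumSq.mul_self _) ht), ?_⟩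
    simp only [map_add, map_mul, ← e, ← hnm]
    ring

/-- If `f ∈ ℝ[[x,y]]` is nonnegative at every ordering of `ℝ((x,y))`,
then `f` is a sum of two squares in `ℝ[[x,y]]`: `f = g² + h²` for some `g, h`. -/
theorem psd_implies_sum_of_two_squares (f : PS)
    (hf : ∀ P : Set FF, IsOrderingF P → ι f ∈ P) :
    ∃ g h : PS, f = g ^ 2 + h ^ 2 := by
  have hinj : Function.Injective (algebraMap PS FF) := IsFractionRing.injective _ _
  have hchar : CharZero FF :=
    charZero_of_injective_ringHom
      ((ι.comp (MvPowerSeries.C (σ := Fin 2) (R := ℝ))).injective)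
  obtain ⟨d, t, hd, ht, e⟩ := clear_denominators _ (artin (ι f) hf)
  have e2 : f * d ^ 2 = t := hinj (by rw [map_mul, map_pow]; exact e)
  have h1 : IsSumSq (psEquiv f * psEquiv d ^ 2) := by
    rw [← map_pow, ← map_mul, e2]
    exact ht.map_hom (psEquiv : PS →+* PowerSeries (PowerSeries ℝ))
  obtain ⟨g, h, hgh⟩ := main_induction unit_case (fun f _ hf => factor_case f hf) (psEquiv f)
    (psEquiv d) (by simpa using hd) h1
  refine ⟨psEquiv.symm g, psEquiv.symm h, ?_⟩
  apply psEquiv.injective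
  simp [hgh]
end
end
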